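/- arXiv:0710.4998 — 8 statements merged into one kernel-verified Lean document; each statement's English description precedes it below -/
import Mathlib

section
/- A nonnegative integer n is represented by the quaternary quadratic form x₁² + x₂² + 8y₁² + 8y₂² if and only if n ≡ 0 or 1 (mod 4), or n ≡ 2 (mod 8). (This is the regularity of the binary Hermitian lattice ⟨1,8⟩ over ℚ(√-1), stated for its associated quadratic form.) -/
/-- Two integers of equal parity are `s + t` and `s - t`, so that `4c² + 4d² = 8s² + 8t²`. -/
theorem exists_sq_add_sq_add_eight_of_even_add {n a b c d : ℤ}
    (h : a ^ 2 + b ^ 2 + 4 * c ^ 2 + 4 * d ^ 2 = n) (hcd : Even (c + d)) :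
    ∃ x1 x2 y1 y2 : ℤ, x1^2 + x2^2 + 8*y1^2 + 8*y2^2 = n := by
  obtain ⟨s, hs⟩ := hcd
  obtain rfl : d = 2 * s - c := by linarith
  exact ⟨a, b, s, s - c, by linear_combination h⟩

theorem exists_sq_add_sq_add_eight_of_three_even {n a b c d : ℤ}
    (h : a ^ 2 + 4 * b ^ 2 + 4 * c ^ 2 + 4 * d ^ 2 = n) :
    ∃ x1 x2 y1 y2 : ℤ, x1^2 + x2^2 + 8*y1^2 + 8*y2^2 = n := by
  have parity : Even (c + d) ∨ Even (b + d) ∨ Even (b + c) := by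
    simp only [Int.even_iff]; omega
  rcases parity with hp | hp | hp
  · exact exists_sq_add_sq_add_eight_of_even_add (a := a) (b := 2 * b) (by linarith) hp
  · exact exists_sq_add_sq_add_eight_of_even_add (a := a) (b := 2 * c) (by linarith) hp
  · exact exists_sq_add_sq_add_eight_of_even_add (a := a) (b := 2 * d) (by linarith) hp

theorem exists_sq_add_sq_add_eight_of_two_odd {n a b c d : ℤ} (hn : n % 8 = 2)
    (h : (2 * a + 1) ^ 2 + (2 * b + 1) ^ 2 + 4 * c ^ 2 + 4 * d ^ 2 = n) :
    ∃ x1 x2 y1 y2 : ℤ, x1^2 + x2^2 + 8*y1^2 + 8*y2^2 = n := by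
  refine exists_sq_add_sq_add_eight_of_even_add h ?_
  obtain ⟨u, hu⟩ := Int.even_mul_succ_self a
  obtain ⟨v, hv⟩ := Int.even_mul_succ_self b
  obtain ⟨s, hs⟩ := Int.even_mul_succ_self c
  obtain ⟨t, ht⟩ := Int.even_mul_succ_self d
  have : n = 8 * u + 8 * v + 2 + 8 * s + 8 * t - 4 * (c + d) := by
    linear_combination -h + 4 * hu + 4 * hv + 4 * hs + 4 * ht
  rw [Int.even_iff]
  omega

theorem exists_sq_add_sq_add_eight {n : ℤ} (hn : 0 ≤ n)
    (h : n % 4 = 0 ∨ n % 4 = 1 ∨ n % 8 = 2) :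
    ∃ x1 x2 y1 y2 : ℤ, x1^2 + x2^2 + 8*y1^2 + 8*y2^2 = n := by
  rcases h with h0 | h
  · obtain ⟨a, b, c, d, hm⟩ := Nat.sum_four_squares (n / 4).toNat
    have hm' : (a : ℤ) ^ 2 + b ^ 2 + c ^ 2 + d ^ 2 = n / 4 := by
      rw [← Int.toNat_of_nonneg (show 0 ≤ n / 4 by omega), ← hm]; push_cast; rfl
    exact exists_sq_add_sq_add_eight_of_three_even (a := 2 * a) (b := b) (c := c) (d := d)
      (by rw [mul_pow]; omega)
  obtain ⟨a, b, c, d, hm⟩ : ∃ a b c d : ℤ, a ^ 2 + b ^ 2 + c ^ 2 + d ^ 2 = n := by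
    obtain ⟨a, b, c, d, hm⟩ := Nat.sum_four_squares n.toNat
    exact ⟨a, b, c, d, by rw [← Int.toNat_of_nonneg hn, ← hm]; push_cast; rfl⟩
  rcases Int.even_or_odd' a with ⟨a, rfl | rfl⟩ <;>
  rcases Int.even_or_odd' b with ⟨b, rfl | rfl⟩ <;>
  rcases Int.even_or_odd' c with ⟨c, rfl | rfl⟩ <;>
  rcases Int.even_or_odd' d with ⟨d, rfl | rfl⟩ <;>
  first
  | (exfalso; ring_nf at hm; omega)
  | exact exists_sq_add_sq_add_eight_of_three_even (a := 2 * a + 1) (b := b) (c := c) (d := d)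
      (by linarith)
  | exact exists_sq_add_sq_add_eight_of_three_even (a := 2 * b + 1) (b := a) (c := c) (d := d)
      (by linarith)
  | exact exists_sq_add_sq_add_eight_of_three_even (a := 2 * c + 1) (b := a) (c := b) (d := d)
      (by linarith)
  | exact exists_sq_add_sq_add_eight_of_three_even (a := 2 * d + 1) (b := a) (c := b) (d := c)
      (by linarith)
  | (have h2 : n % 8 = 2 := by ring_nf at hm; omega
     first
     | exact exists_sq_add_sq_add_eight_of_two_odd (a := a) (b := b) (c := c) (d := d) h2
        (by linarith)
     | exact exists_sq_add_sq_add_eight_of_two_odd (a := a) (b := c) (c := b) (d := d) h2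
        (by linarith)
     | exact exists_sq_add_sq_add_eight_of_two_odd (a := a) (b := d) (c := b) (d := c) h2
        (by linarith)
     | exact exists_sq_add_sq_add_eight_of_two_odd (a := b) (b := c) (c := a) (d := d) h2
        (by linarith)
     | exact exists_sq_add_sq_add_eight_of_two_odd (a := b) (b := d) (c := a) (d := c) h2
        (by linarith)
     | exact exists_sq_add_sq_add_eight_of_two_odd (a := c) (b := d) (c := a) (d := b) h2
        (by linarith))

theorem sq_emod_eight (x : ℤ) : x ^ 2 % 8 = 0 ∨ x ^ 2 % 8 = 1 ∨ x ^ 2 % 8 = 4 := by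
  have : x % 8 = 0 ∨ x % 8 = 1 ∨ x % 8 = 2 ∨ x % 8 = 3 ∨ x % 8 = 4 ∨ x % 8 = 5 ∨ x % 8 = 6 ∨
      x % 8 = 7 := by omega
  rcases this with h | h | h | h | h | h | h | h <;> simp [pow_two, Int.mul_emod, h]

theorem stmt_0 (n : ℤ) (hn : 0 ≤ n) :
    (∃ x1 x2 y1 y2 : ℤ, x1^2 + x2^2 + 8*y1^2 + 8*y2^2 = n) ↔
    (n % 4 = 0 ∨ n % 4 = 1 ∨ n % 8 = 2) := by
  refine ⟨?_, exists_sq_add_sq_add_eight hn⟩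
  rintro ⟨x1, x2, y1, y2, h⟩
  have h1 := sq_emod_eight x1
  have h2 := sq_emod_eight x2
  omega
end

section
/- A nonnegative integer n is represented by the quaternary quadratic form x₁² + x₂² + 16y₁² + 16y₂² if and only if n ≡ 1 (mod 4), or n ≡ 0 or 2 (mod 8), or n ≡ 4 (mod 16). (This is the regularity of the binary Hermitian lattice ⟨1,16⟩ over ℚ(√-1), stated for its associated quadratic form.) -/
/-- An odd integer becomes congruent to `1` modulo `4` after a suitable choice of sign. -/
theorem Int.exists_sq_eq_sq_of_odd {x : ℤ} (hx : x % 2 = 1) :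
    ∃ y : ℤ, (4 * y + 1) ^ 2 = x ^ 2 := by
  rcases (by lia : x % 4 = 1 ∨ x % 4 = 3) with h | h
  · exact ⟨x / 4, by rw [show 4 * (x / 4) + 1 = x by lia]⟩
  · exact ⟨(-x) / 4, by rw [show 4 * (-x / 4) + 1 = -x by lia, neg_sq]⟩

theorem Int.sq_emod_four (x : ℤ) : x ^ 2 % 4 = x % 2 := by
  obtain ⟨k, rfl | rfl⟩ := Int.even_or_odd' x
  · rw [show (2 * k) ^ 2 = 4 * k ^ 2 by ring]
    lia
  · rw [show (2 * k + 1) ^ 2 = 4 * (k ^ 2 + k) + 1 by ring]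
    lia

/-- A natural number congruent to `3` modulo `4` is a sum of four squares, one of an even integer
and three of integers congruent to `1` modulo `4`. -/
theorem Nat.exists_sum_four_squares_of_mod_four_eq_three {m : ℕ} (hm : m % 4 = 3) :
    ∃ e a b c : ℤ,
      (2 * e) ^ 2 + (4 * a + 1) ^ 2 + (4 * b + 1) ^ 2 + (4 * c + 1) ^ 2 = m := by
  have key {w x y z : ℤ} (h : w ^ 2 + x ^ 2 + y ^ 2 + z ^ 2 = m) (hw : w % 2 = 0)
      (hx : x % 2 = 1) (hy : y % 2 = 1) (hz : z % 2 = 1) : ∃ e a b c : ℤ,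
      (2 * e) ^ 2 + (4 * a + 1) ^ 2 + (4 * b + 1) ^ 2 + (4 * c + 1) ^ 2 = m := by
    obtain ⟨a, ha⟩ := Int.exists_sq_eq_sq_of_odd hx
    obtain ⟨b, hb⟩ := Int.exists_sq_eq_sq_of_odd hy
    obtain ⟨c, hc⟩ := Int.exists_sq_eq_sq_of_odd hz
    exact ⟨w / 2, a, b, c, by rw [ha, hb, hc, show 2 * (w / 2) = w by lia, h]⟩
  obtain ⟨w, x, y, z, h⟩ := Nat.sum_four_squares m
  zify at h
  have hw := Int.sq_emod_four w
  have hx := Int.sq_emod_four x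
  have hy := Int.sq_emod_four y
  have hz := Int.sq_emod_four z
  rcases Int.emod_two_eq_zero_or_one w with h₁ | h₁
  · exact key h h₁ (by lia) (by lia) (by lia)
  rcases Int.emod_two_eq_zero_or_one x with h₂ | h₂
  · exact key (w := x) (x := w) (y := y) (z := z) (by linarith) h₂ h₁ (by lia) (by lia)
  rcases Int.emod_two_eq_zero_or_one y with h₃ | h₃
  · exact key (w := y) (x := w) (y := x) (z := z) (by linarith) h₃ h₁ h₂ (by lia)
  · exact key (w := z) (x := w) (y := x) (z := y) (by linarith) (by lia) h₁ h₂ h₃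

/-- The product of two natural numbers congruent to `3` modulo `4` is represented by the form
`x₁² + x₂² + 16 y₁² + 16 y₂²`. The representation comes from Euler's four-square identity. -/
theorem Nat.exists_mul_eq_of_mod_four_eq_three {m n : ℕ} (hm : m % 4 = 3) (hn : n % 4 = 3) :
    ∃ x₁ x₂ y₁ y₂ : ℤ, x₁ ^ 2 + x₂ ^ 2 + 16 * y₁ ^ 2 + 16 * y₂ ^ 2 = m * n := by
  obtain ⟨e, a, b, c, h⟩ := Nat.exists_sum_four_squares_of_mod_four_eq_three hm
  obtain ⟨f, s, t, u, h'⟩ := Nat.exists_sum_four_squares_of_mod_four_eq_three hn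
  rw [← h, ← h']
  obtain ⟨g, hg | hg⟩ := Int.even_or_odd' (e + f)
  · obtain rfl : f = 2 * g - e := by lia
    refine ⟨2 * e * (2 * (2 * g - e)) - (4 * a + 1) * (4 * s + 1) - (4 * b + 1) * (4 * t + 1)
        - (4 * c + 1) * (4 * u + 1),
      2 * e * (4 * s + 1) + (4 * a + 1) * (2 * (2 * g - e)) + (4 * b + 1) * (4 * u + 1)
        - (4 * c + 1) * (4 * t + 1),
      2 * e * t - 4 * a * u - a - u + 2 * b * (2 * g - e) + g + 4 * c * s + c + s,
      2 * e * u + 4 * a * t + a + t - 4 * b * s - b - s + 2 * c * (2 * g - e) + g, ?_⟩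
    ring
  · obtain rfl : f = 2 * g + 1 - e := by lia
    refine ⟨2 * e * (2 * (2 * g + 1 - e)) - (4 * a + 1) * (4 * s + 1)
        + (4 * b + 1) * (4 * t + 1) - (4 * c + 1) * (4 * u + 1),
      -(2 * e * (4 * t + 1)) - (4 * a + 1) * (4 * u + 1) + (4 * b + 1) * (2 * (2 * g + 1 - e))
        + (4 * c + 1) * (4 * s + 1),
      2 * e * s + 2 * a * (2 * g + 1 - e) + g + 4 * b * u + b + u + 4 * c * t + c + t + 1,
      2 * e * u - 4 * a * t - a - t - 4 * b * s - b - s + 2 * c * (2 * g + 1 - e) + g, ?_⟩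
    ring

theorem Nat.exists_sq_add_sq_add_sixteen_mul_of_mod_four_eq_one {n : ℕ} (hn : n % 4 = 1) :
    ∃ x₁ x₂ y₁ y₂ : ℤ, x₁ ^ 2 + x₂ ^ 2 + 16 * y₁ ^ 2 + 16 * y₂ ^ 2 = n := by
  by_cases h : ∃ q ∈ n.primeFactors, q % 4 = 3
  · obtain ⟨q, hq, hq3⟩ := h
    obtain ⟨m, rfl⟩ := Nat.dvd_of_mem_primeFactors hq
    have hm : m % 4 = 3 := by
      rw [Nat.mul_mod, hq3] at hn
      omega
    simpa using Nat.exists_mul_eq_of_mod_four_eq_three hq3 hm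
  · obtain ⟨x, y, rfl⟩ := Nat.eq_sq_add_sq_iff.2 fun q hq hq3 ↦ (h ⟨q, hq, hq3⟩).elim
    exact ⟨x, y, 0, 0, by simp⟩

/-- The form `x² + y² + 2z² + 2w²` is universal. -/
theorem Nat.exists_sq_add_sq_add_two_mul (n : ℕ) :
    ∃ x y z w : ℤ, x ^ 2 + y ^ 2 + 2 * z ^ 2 + 2 * w ^ 2 = n := by
  have key {a b c d : ℤ} (h : a ^ 2 + b ^ 2 + c ^ 2 + d ^ 2 = n) (hcd : c % 2 = d % 2) :
      ∃ x y z w : ℤ, x ^ 2 + y ^ 2 + 2 * z ^ 2 + 2 * w ^ 2 = n := by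
    obtain ⟨k, hk⟩ : (2 : ℤ) ∣ c - d := by lia
    obtain rfl : c = d + 2 * k := by lia
    exact ⟨a, b, d + k, k, by linear_combination h⟩
  obtain ⟨a, b, c, d, h⟩ := Nat.sum_four_squares n
  zify at h
  by_cases h₁ : (c : ℤ) % 2 = d % 2
  · exact key h h₁
  by_cases h₂ : (b : ℤ) % 2 = d % 2
  · exact key (a := a) (b := c) (c := b) (d := d) (by linarith) h₂
  · exact key (a := a) (b := d) (c := b) (d := c) (by linarith) (by lia)

theorem stmt_1 (n : ℤ) (hn : 0 ≤ n) :
    (∃ x1 x2 y1 y2 : ℤ, x1^2 + x2^2 + 16*y1^2 + 16*y2^2 = n) ↔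
    (n % 4 = 1 ∨ n % 8 = 0 ∨ n % 8 = 2 ∨ n % 16 = 4) := by
  constructor
  · rintro ⟨x, y, z, w, h⟩
    have sq_mod (t : ℤ) : t ^ 2 % 16 = 0 ∨ t ^ 2 % 16 = 1 ∨ t ^ 2 % 16 = 4 ∨ t ^ 2 % 16 = 9 := by
      have : t % 16 = 0 ∨ t % 16 = 1 ∨ t % 16 = 2 ∨ t % 16 = 3 ∨ t % 16 = 4 ∨ t % 16 = 5 ∨
        t % 16 = 6 ∨ t % 16 = 7 ∨ t % 16 = 8 ∨ t % 16 = 9 ∨ t % 16 = 10 ∨ t % 16 = 11 ∨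
        t % 16 = 12 ∨ t % 16 = 13 ∨ t % 16 = 14 ∨ t % 16 = 15 := by lia
      rcases this with h | h | h | h | h | h | h | h | h | h | h | h | h | h | h | h <;>
        simp [sq, Int.mul_emod, h]
    have hx := sq_mod x
    have hy := sq_mod y
    lia
  · lift n to ℕ using hn
    intro h
    rcases (by lia : n % 4 = 1 ∨ n % 8 = 0 ∨ n % 8 = 2 ∨ n % 16 = 4) with h | h | h | h
    · exact Nat.exists_sq_add_sq_add_sixteen_mul_of_mod_four_eq_one h
    · obtain ⟨m, rfl⟩ : 8 ∣ n := by lia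
      obtain ⟨x, y, z, w, h⟩ := Nat.exists_sq_add_sq_add_two_mul m
      exact ⟨2 * (x + y), 2 * (x - y), z, w, by push_cast; linear_combination 8 * h⟩
    · obtain ⟨m, rfl⟩ : 2 ∣ n := by lia
      obtain ⟨x, y, z, w, h⟩ :=
        Nat.exists_sq_add_sq_add_sixteen_mul_of_mod_four_eq_one (n := m) (by lia)
      exact ⟨x + y, x - y, z + w, z - w, by push_cast; linear_combination 2 * h⟩
    · obtain ⟨m, rfl⟩ : 4 ∣ n := by lia
      obtain ⟨x, y, z, w, h⟩ :=
        Nat.exists_sq_add_sq_add_sixteen_mul_of_mod_four_eq_one (n := m) (by lia)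
      exact ⟨2 * x, 2 * y, 2 * z, 2 * w, by push_cast; linear_combination 4 * h⟩
end

section
/- A nonnegative integer n is represented by the quaternary quadratic form x₁² + 2x₂² + 8y₁² + 16y₂² if and only if n ≡ 1 or 3 (mod 8), or n ≡ 0 (mod 2). (This is the regularity of the binary Hermitian lattice ⟨1,8⟩ over ℚ(√-2), stated for its associated quadratic form.) -/
/-- Squares of integers modulo 8, in terms of residues modulo 4. -/
lemma sq_emod_eight_cases (a : ℤ) :
    (a % 4 = 0 ∧ a ^ 2 % 8 = 0) ∨ (a % 4 = 2 ∧ a ^ 2 % 8 = 4) ∨ (a % 2 = 1 ∧ a ^ 2 % 8 = 1) := by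
  have h : a % 8 = 0 ∨ a % 8 = 1 ∨ a % 8 = 2 ∨ a % 8 = 3 ∨ a % 8 = 4 ∨ a % 8 = 5 ∨
      a % 8 = 6 ∨ a % 8 = 7 := by omega
  rcases h with h | h | h | h | h | h | h | h <;>
    · have h2 : a ^ 2 % 8 = (a % 8) ^ 2 % 8 := ((Int.mod_modEq a 8).pow 2).symm
      rw [h] at h2
      norm_num at h2
      omega

lemma sum_four_squares_int {n : ℤ} (hn : 0 ≤ n) :
    ∃ a b c d : ℤ, a ^ 2 + b ^ 2 + c ^ 2 + d ^ 2 = n := by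
  obtain ⟨a, b, c, d, h⟩ := Nat.sum_four_squares n.toNat
  refine ⟨a, b, c, d, ?_⟩
  have h' : ((a ^ 2 + b ^ 2 + c ^ 2 + d ^ 2 : ℕ) : ℤ) = n := by rw [h, Int.toNat_of_nonneg hn]
  exact_mod_cast h'

lemma represented_of_four_dvd {n a b c d : ℤ} (h : a ^ 2 + b ^ 2 + c ^ 2 + d ^ 2 = n)
    (hd : d % 4 = 0) (hbc : (b - c) % 4 = 0 ∨ (b + c) % 4 = 0) :
    ∃ x1 x2 y1 y2 : ℤ, x1 ^ 2 + 2 * x2 ^ 2 + 8 * y1 ^ 2 + 16 * y2 ^ 2 = n := by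
  obtain ⟨e, rfl⟩ := Int.dvd_of_emod_eq_zero hd
  rcases hbc with hbc | hbc <;> obtain ⟨k, hk⟩ := Int.dvd_of_emod_eq_zero hbc
  · obtain rfl : b = c + 4 * k := by omega
    exact ⟨a, c + 2 * k, k, e, by linear_combination h⟩
  · obtain rfl : b = 4 * k - c := by omega
    exact ⟨a, 2 * k - c, k, e, by linear_combination h⟩

/-- The form `⟨1, 2, 4, 8⟩` represents a sum of four squares satisfying suitable congruences. -/
lemma diagonal_of_even {m p q r s : ℤ} (h : p ^ 2 + q ^ 2 + r ^ 2 + s ^ 2 = m)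
    (hr : r % 2 = 0) (hpq : (p - q) % 4 = 0 ∨ (p + q) % 4 = 0) :
    ∃ a b c d : ℤ, a ^ 2 + 2 * b ^ 2 + 4 * c ^ 2 + 8 * d ^ 2 = m := by
  obtain ⟨c, rfl⟩ := Int.dvd_of_emod_eq_zero hr
  rcases hpq with hpq | hpq <;> obtain ⟨k, hk⟩ := Int.dvd_of_emod_eq_zero hpq
  · obtain rfl : p = q + 4 * k := by omega
    exact ⟨s, q + 2 * k, c, k, by linear_combination h⟩
  · obtain rfl : p = 4 * k - q := by omega
    exact ⟨s, 2 * k - q, c, k, by linear_combination h⟩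

lemma diagonal_of_exists_even {m p q r s : ℤ} (h : p ^ 2 + q ^ 2 + r ^ 2 + s ^ 2 = m)
    (hr : r % 2 = 0) : ∃ a b c d : ℤ, a ^ 2 + 2 * b ^ 2 + 4 * c ^ 2 + 8 * d ^ 2 = m := by
  by_cases hpq : (p - q) % 4 = 0 ∨ (p + q) % 4 = 0
  · exact diagonal_of_even h hr hpq
  by_cases hps : (p - s) % 4 = 0 ∨ (p + s) % 4 = 0
  · exact diagonal_of_even (q := s) (s := q) (by linarith) hr hps
  by_cases hqs : (q - s) % 4 = 0 ∨ (q + s) % 4 = 0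
  · exact diagonal_of_even (p := q) (q := s) (s := p) (by linarith) hr hqs
  by_cases hrp : (r - p) % 4 = 0
  · by_cases hq : q % 2 = 0
    · exact diagonal_of_even (p := r) (q := p) (r := q) (s := s) (by linarith) hq (.inl hrp)
    · exact diagonal_of_even (p := r) (q := p) (r := s) (s := q) (by linarith) (by omega)
        (.inl hrp)
  by_cases hrq : (r - q) % 4 = 0
  · by_cases hp : p % 2 = 0
    · exact diagonal_of_even (p := r) (q := q) (r := p) (s := s) (by linarith) hp (.inl hrq)
    · exact diagonal_of_even (p := r) (q := q) (r := s) (s := p) (by linarith) (by omega)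
        (.inl hrq)
  by_cases hp : p % 2 = 0
  · exact diagonal_of_even (p := r) (q := s) (r := p) (s := q) (by linarith) hp (by omega)
  · exact diagonal_of_even (p := r) (q := s) (r := q) (s := p) (by linarith) (by omega) (by omega)

/-- The form `⟨1, 2, 4, 8⟩` is universal. -/
lemma diagonal_one_two_four_eight_universal {m : ℤ} (hm : 0 ≤ m) :
    ∃ a b c d : ℤ, a ^ 2 + 2 * b ^ 2 + 4 * c ^ 2 + 8 * d ^ 2 = m := by
  by_cases h4 : m % 4 = 0
  · obtain ⟨k, rfl⟩ := Int.dvd_of_emod_eq_zero h4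
    obtain ⟨a, b, c, d, h⟩ := sum_four_squares_int (n := k) (by omega)
    exact diagonal_of_exists_even (p := 2 * a) (q := 2 * b) (r := 2 * c) (s := 2 * d)
      (by linear_combination 4 * h) (by omega)
  · obtain ⟨a, b, c, d, h⟩ := sum_four_squares_int hm
    by_cases ha : a % 2 = 0
    · exact diagonal_of_exists_even (p := b) (q := c) (r := a) (s := d) (by linarith) ha
    by_cases hb : b % 2 = 0
    · exact diagonal_of_exists_even (p := a) (q := c) (r := b) (s := d) (by linarith) hb
    by_cases hc : c % 2 = 0
    · exact diagonal_of_exists_even h hc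
    · have := sq_emod_eight_cases a
      have := sq_emod_eight_cases b
      have := sq_emod_eight_cases c
      have := sq_emod_eight_cases d
      exact diagonal_of_exists_even (p := a) (q := b) (r := d) (s := c) (by linarith) (by omega)

lemma represented_of_exists_four_dvd {n a b c d : ℤ} (h : a ^ 2 + b ^ 2 + c ^ 2 + d ^ 2 = n)
    (hd : d % 4 = 0) (hn : n % 8 = 1 ∨ n % 8 = 3) :
    ∃ x1 x2 y1 y2 : ℤ, x1 ^ 2 + 2 * x2 ^ 2 + 8 * y1 ^ 2 + 16 * y2 ^ 2 = n := by
  by_cases hbc : (b - c) % 4 = 0 ∨ (b + c) % 4 = 0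
  · exact represented_of_four_dvd h hd hbc
  by_cases hac : (a - c) % 4 = 0 ∨ (a + c) % 4 = 0
  · exact represented_of_four_dvd (a := b) (b := a) (by linarith) hd hac
  have := sq_emod_eight_cases a
  have := sq_emod_eight_cases b
  have := sq_emod_eight_cases c
  have := sq_emod_eight_cases d
  exact represented_of_four_dvd (a := c) (b := a) (c := b) (by linarith) hd (by omega)

lemma represented_of_emod_eight {n : ℤ} (h0 : 0 ≤ n) (hn : n % 8 = 1 ∨ n % 8 = 3) :
    ∃ x1 x2 y1 y2 : ℤ, x1 ^ 2 + 2 * x2 ^ 2 + 8 * y1 ^ 2 + 16 * y2 ^ 2 = n := by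
  obtain ⟨a, b, c, d, h⟩ := sum_four_squares_int h0
  by_cases hd : d % 4 = 0
  · exact represented_of_exists_four_dvd h hd hn
  by_cases hc : c % 4 = 0
  · exact represented_of_exists_four_dvd (a := a) (b := b) (c := d) (d := c) (by linarith) hc hn
  by_cases hb : b % 4 = 0
  · exact represented_of_exists_four_dvd (a := a) (b := d) (c := c) (d := b) (by linarith) hb hn
  have := sq_emod_eight_cases a
  have := sq_emod_eight_cases b
  have := sq_emod_eight_cases c
  have := sq_emod_eight_cases d
  exact represented_of_exists_four_dvd (a := d) (b := b) (c := c) (d := a)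
      (by linarith) (by omega) hn

theorem stmt_2 (n : ℤ) (hn : 0 ≤ n) :
    (∃ x1 x2 y1 y2 : ℤ, x1^2 + 2*x2^2 + 8*y1^2 + 16*y2^2 = n) ↔
    (n % 8 = 1 ∨ n % 8 = 3 ∨ n % 2 = 0) := by
  constructor
  · rintro ⟨x1, x2, y1, y2, h⟩
    have := sq_emod_eight_cases x1
    have := sq_emod_eight_cases x2
    omega
  · intro h
    by_cases h2 : n % 2 = 0
    · obtain ⟨m, rfl⟩ := Int.dvd_of_emod_eq_zero h2
      obtain ⟨a, b, c, d, h⟩ := diagonal_one_two_four_eight_universal (m := m) (by omega)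
      exact ⟨2 * b, a, c, d, by linear_combination 2 * h⟩
    · exact represented_of_emod_eight hn (by omega)
end

section
/- A nonnegative integer n is represented by the quaternary quadratic form 2x₁² + 4x₂² + 4x₁y₂ − 4x₂y₁ + 5y₁² + 10y₂² if and only if n ≡ 0 (mod 2), or n ≡ 5 or 7 (mod 8). (This is the regularity of the nondiagonal binary Hermitian lattice with Gram matrix [[2, √-2],[−√-2, 5]] over ℚ(√-2), stated for its associated quadratic form.) -/
/-- Odd squares are `1` modulo `8`. -/
lemma sq_odd_form (k : ℤ) : ∃ t : ℤ, (2 * k + 1) ^ 2 = 8 * t + 1 := by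
  obtain ⟨t, ht⟩ := (Int.even_mul_succ_self k).two_dvd
  exact ⟨t, by linear_combination 4 * ht⟩

/-- Even squares are `0` or `4` modulo `8`. -/
lemma sq_even_form (k : ℤ) :
    ∃ t : ℤ, (2 * k) ^ 2 = 8 * t ∧ k % 2 = 0 ∨ (2 * k) ^ 2 = 8 * t + 4 ∧ k % 2 = 1 := by
  obtain ⟨j, rfl | rfl⟩ := k.even_or_odd'
  · exact ⟨2 * j ^ 2, Or.inl ⟨by ring, by omega⟩⟩
  · exact ⟨2 * j ^ 2 + 2 * j, Or.inr ⟨by ring, by omega⟩⟩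

/-- Lagrange's theorem with the summands arranged by parity. -/
lemma sum_four_squares_sorted (m : ℤ) (hm : 0 ≤ m) : ∃ p q r s : ℤ,
    p ^ 2 + q ^ 2 + r ^ 2 + s ^ 2 = m ∧
      p % 2 ≤ q % 2 ∧ q % 2 ≤ r % 2 ∧ r % 2 ≤ s % 2 := by
  lift m to ℕ using hm
  obtain ⟨a, b, c, d, h⟩ := Nat.sum_four_squares m
  have h' : (a : ℤ) ^ 2 + (b : ℤ) ^ 2 + (c : ℤ) ^ 2 + (d : ℤ) ^ 2 = m := by exact_mod_cast h
  generalize (a : ℤ) = a at h'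
  generalize (b : ℤ) = b at h'
  generalize (c : ℤ) = c at h'
  generalize (d : ℤ) = d at h'
  have insert_sorted : ∀ x y z w : ℤ, x % 2 ≤ y % 2 → y % 2 ≤ z % 2 →
      x ^ 2 + y ^ 2 + z ^ 2 + w ^ 2 = m → ∃ p q r s : ℤ,
        p ^ 2 + q ^ 2 + r ^ 2 + s ^ 2 = m ∧
          p % 2 ≤ q % 2 ∧ q % 2 ≤ r % 2 ∧ r % 2 ≤ s % 2 := by
    intro x y z w hxy hyz hsum
    rcases Int.emod_two_eq_zero_or_one w with hw | hw
    · exact ⟨w, x, y, z, by linarith, by omega, hxy, hyz⟩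
    · exact ⟨x, y, z, w, hsum, hxy, hyz, by omega⟩
  wlog hab : a % 2 ≤ b % 2 generalizing a b
  · exact this b a (by linarith) (by omega)
  rcases Int.emod_two_eq_zero_or_one c with hc | hc
  · exact insert_sorted c a b d (by omega) hab (by linarith)
  · exact insert_sorted a b c d hab (by omega) h'

/-- Among three integers two have the same parity. -/
lemma sum_three_squares_pair (p q r : ℤ) : ∃ u v z : ℤ,
    (u + v) ^ 2 + (u - v) ^ 2 + z ^ 2 = p ^ 2 + q ^ 2 + r ^ 2 := by
  have same_parity : ∀ x y : ℤ, x % 2 = y % 2 → ∃ u v : ℤ, u + v = x ∧ u - v = y :=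
    fun x y h => ⟨(x + y) / 2, (x - y) / 2, by omega, by omega⟩
  have h : p % 2 = q % 2 ∨ p % 2 = r % 2 ∨ q % 2 = r % 2 := by omega
  rcases h with h | h | h
  · obtain ⟨u, v, rfl, rfl⟩ := same_parity _ _ h
    exact ⟨u, v, r, by ring⟩
  · obtain ⟨u, v, rfl, rfl⟩ := same_parity _ _ h
    exact ⟨u, v, q, by ring⟩
  · obtain ⟨u, v, rfl, rfl⟩ := same_parity _ _ h
    exact ⟨u, v, p, by ring⟩

/-- The sum of the squares of two odd integers has the form `2a² + 8b²`. -/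
lemma odd_sq_add_odd_sq (i j : ℤ) : ∃ a b : ℤ,
    (2 * i + 1) ^ 2 + (2 * j + 1) ^ 2 = 2 * a ^ 2 + 8 * b ^ 2 := by
  rcases Int.emod_two_eq_zero_or_one (i + j) with h | h
  · obtain ⟨k, hk⟩ : ∃ k, i = 2 * k - j := ⟨(i + j) / 2, by omega⟩
    subst hk
    exact ⟨2 * k + 1, k - j, by ring⟩
  · obtain ⟨k, hk⟩ : ∃ k, i = 2 * k - 1 - j := ⟨(i + j) / 2 + 1, by omega⟩
    subst hk
    exact ⟨2 * k - 1 - 2 * j, k, by ring⟩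

/-- Ramanujan's form `a² + 2c² + 4b² + 8d²` is universal. -/
lemma exists_sq_add_two_mul_add_four_mul_add_eight_mul (m : ℤ) (hm : 0 ≤ m) :
    ∃ a b c d : ℤ, a ^ 2 + 4 * b ^ 2 + 2 * c ^ 2 + 8 * d ^ 2 = m := by
  by_cases h4 : m % 4 = 0
  · obtain ⟨k, rfl⟩ : ∃ k, m = 4 * k := ⟨m / 4, by omega⟩
    obtain ⟨p, q, r, s, h, -⟩ := sum_four_squares_sorted k (by omega)
    obtain ⟨u, v, z, h'⟩ := sum_three_squares_pair p q r
    exact ⟨2 * s, z, 2 * u, v, by linear_combination 4 * h + 4 * h'⟩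
  obtain ⟨p, q, r, s, h, h1, h2, h3⟩ := sum_four_squares_sorted m hm
  obtain ⟨p, rfl | rfl⟩ := p.even_or_odd'
  · obtain ⟨q, rfl | rfl⟩ := q.even_or_odd'
    · obtain ⟨r, rfl | rfl⟩ := r.even_or_odd'
      · obtain ⟨u, v, z, h'⟩ := sum_three_squares_pair p q r
        exact ⟨s, z, 2 * u, v, by linear_combination h + 4 * h'⟩
      · obtain ⟨s, rfl⟩ : ∃ k, s = 2 * k + 1 := ⟨s / 2, by omega⟩
        obtain ⟨a, b, h'⟩ := odd_sq_add_odd_sq r s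
        exact ⟨2 * p, q, a, b, by linear_combination h - h'⟩
    · obtain ⟨r, rfl⟩ : ∃ k, r = 2 * k + 1 := ⟨r / 2, by omega⟩
      obtain ⟨a, b, h'⟩ := odd_sq_add_odd_sq q r
      exact ⟨s, p, a, b, by linear_combination h - h'⟩
  · obtain ⟨q, rfl⟩ : ∃ k, q = 2 * k + 1 := ⟨q / 2, by omega⟩
    obtain ⟨r, rfl⟩ : ∃ k, r = 2 * k + 1 := ⟨r / 2, by omega⟩
    obtain ⟨s, rfl⟩ : ∃ k, s = 2 * k + 1 := ⟨s / 2, by omega⟩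
    ring_nf at h
    omega

/-- The quaternary form takes every value of `2a² + 8b² + c² + 4d²` with `c ≡ d mod 2`. -/
lemma quaternary_of_diagonal (a b c d : ℤ) (hcd : c % 2 = d % 2) :
    ∃ x1 x2 y1 y2 : ℤ, 2*x1^2 + 4*x2^2 + 4*x1*y2 - 4*x2*y1 + 5*y1^2 + 10*y2^2 =
      2 * a ^ 2 + 8 * b ^ 2 + c ^ 2 + 4 * d ^ 2 := by
  obtain ⟨e, rfl⟩ : ∃ e, c = 2 * e - d := ⟨(c + d) / 2, by omega⟩
  exact ⟨a - b, e, d, b, by ring⟩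

lemma diagonal_of_emod_eight_eq_five_or_seven (n : ℤ) (hn : 0 ≤ n)
    (h57 : n % 8 = 5 ∨ n % 8 = 7) :
    ∃ a b c d : ℤ, c % 2 = d % 2 ∧ 2 * a ^ 2 + 8 * b ^ 2 + c ^ 2 + 4 * d ^ 2 = n := by
  obtain ⟨p, q, r, s, h, h1, h2, h3⟩ := sum_four_squares_sorted n hn
  obtain ⟨p, rfl | rfl⟩ := p.even_or_odd'
  · obtain ⟨q, rfl | rfl⟩ := q.even_or_odd'
    · obtain ⟨r, rfl | rfl⟩ := r.even_or_odd'
      · obtain ⟨s, rfl | rfl⟩ := s.even_or_odd'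
        · ring_nf at h
          omega
        · obtain ⟨u, v, z, h'⟩ := sum_three_squares_pair p q r
          have hn' : 2 * (2 * u) ^ 2 + 8 * v ^ 2 + (2 * s + 1) ^ 2 + 4 * z ^ 2 = n := by
            linear_combination h + 4 * h'
          refine ⟨2 * u, v, 2 * s + 1, z, ?_, hn'⟩
          obtain ⟨t, ht⟩ := sq_odd_form s
          obtain ⟨w, hw⟩ := sq_even_form z
          ring_nf at hn' ht hw
          omega
      · obtain ⟨s, rfl⟩ : ∃ k, s = 2 * k + 1 := ⟨s / 2, by omega⟩
        ring_nf at h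
        omega
    · obtain ⟨r, rfl⟩ : ∃ k, r = 2 * k + 1 := ⟨r / 2, by omega⟩
      obtain ⟨s, rfl⟩ : ∃ k, s = 2 * k + 1 := ⟨s / 2, by omega⟩
      obtain ⟨a, b, h'⟩ := odd_sq_add_odd_sq q r
      refine ⟨a, b, 2 * s + 1, p, ?_, by linear_combination h - h'⟩
      obtain ⟨t, ht⟩ := sq_odd_form q
      obtain ⟨t', ht'⟩ := sq_odd_form r
      obtain ⟨t'', ht''⟩ := sq_odd_form s
      obtain ⟨w, hw⟩ := sq_even_form p
      rw [ht, ht', ht''] at h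
      omega
  · obtain ⟨q, rfl⟩ : ∃ k, q = 2 * k + 1 := ⟨q / 2, by omega⟩
    obtain ⟨r, rfl⟩ : ∃ k, r = 2 * k + 1 := ⟨r / 2, by omega⟩
    obtain ⟨s, rfl⟩ : ∃ k, s = 2 * k + 1 := ⟨s / 2, by omega⟩
    ring_nf at h
    omega

lemma diagonal_emod (a b c d : ℤ) (hcd : c % 2 = d % 2) :
    (2 * a ^ 2 + 8 * b ^ 2 + c ^ 2 + 4 * d ^ 2) % 2 = 0 ∨
      (2 * a ^ 2 + 8 * b ^ 2 + c ^ 2 + 4 * d ^ 2) % 8 = 5 ∨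
      (2 * a ^ 2 + 8 * b ^ 2 + c ^ 2 + 4 * d ^ 2) % 8 = 7 := by
  obtain ⟨c, rfl | rfl⟩ := c.even_or_odd'
  · left
    ring_nf
    omega
  · right
    obtain ⟨d, rfl⟩ : ∃ k, d = 2 * k + 1 := ⟨d / 2, by omega⟩
    obtain ⟨t, ht⟩ := sq_odd_form c
    obtain ⟨t', ht'⟩ := sq_odd_form d
    rw [ht, ht']
    obtain ⟨a, rfl | rfl⟩ := a.even_or_odd'
    · ring_nf
      omega
    · obtain ⟨t'', ht''⟩ := sq_odd_form a
      rw [ht'']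
      omega

theorem stmt_5 (n : ℤ) (hn : 0 ≤ n) :
    (∃ x1 x2 y1 y2 : ℤ, 2*x1^2 + 4*x2^2 + 4*x1*y2 - 4*x2*y1 + 5*y1^2 + 10*y2^2 = n) ↔
    (n % 2 = 0 ∨ n % 8 = 5 ∨ n % 8 = 7) := by
  constructor
  · rintro ⟨x1, x2, y1, y2, rfl⟩
    convert diagonal_emod (x1 + y2) y2 (2 * x2 - y1) y1 (by omega) using 3 <;> ring_nf
  · rintro (h | h)
    · obtain ⟨m, rfl⟩ : ∃ m, n = 2 * m := ⟨n / 2, by omega⟩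
      obtain ⟨a, b, c, d, hm⟩ :=
        exists_sq_add_two_mul_add_four_mul_add_eight_mul m (by omega)
      obtain ⟨x1, x2, y1, y2, hx⟩ := quaternary_of_diagonal a b (2 * c) (2 * d) (by omega)
      exact ⟨x1, x2, y1, y2, by linear_combination hx + 2 * hm⟩
    · obtain ⟨a, b, c, d, hcd, rfl⟩ := diagonal_of_emod_eight_eq_five_or_seven n hn h
      exact quaternary_of_diagonal a b c d hcd
end

section
/- A nonnegative integer n is represented by the quaternary quadratic form x₁² + x₁x₂ + x₂² + 9y₁² + 9y₁y₂ + 9y₂² if and only if n ≡ 1 (mod 3), or n ≡ 0 or 3 (mod 9). (This is the regularity of the binary Hermitian lattice ⟨1,9⟩ over ℚ(√-3), stated for its associated quadratic form.) -/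
/-- The norm form of the Eisenstein integers: the norm of `x + ω y` with `ω ^ 2 = ω - 1`. -/
def eisNorm (x y : ℤ) : ℤ := x ^ 2 + x * y + y ^ 2

/-- `n` is represented by the binary Hermitian form `⟨1, k⟩` over the Eisenstein integers. -/
def EisRep (k n : ℤ) : Prop :=
  ∃ a₁ a₂ b₁ b₂ : ℤ, eisNorm a₁ a₂ + k * eisNorm b₁ b₂ = n

theorem eisNorm_nonneg (x y : ℤ) : 0 ≤ eisNorm x y := by
  unfold eisNorm
  nlinarith [sq_nonneg (x + y), sq_nonneg x, sq_nonneg y]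

theorem eq_zero_of_eisNorm_eq_zero {x y : ℤ} (h : eisNorm x y = 0) : x = 0 ∧ y = 0 := by
  unfold eisNorm at h
  constructor <;> nlinarith [sq_nonneg (x + y), sq_nonneg x, sq_nonneg y]

theorem eisNorm_emod_three (x y : ℤ) : eisNorm x y % 3 = 0 ∨ eisNorm x y % 3 = 1 := by
  have hx : x % 3 = 0 ∨ x % 3 = 1 ∨ x % 3 = 2 := by omega
  have hy : y % 3 = 0 ∨ y % 3 = 1 ∨ y % 3 = 2 := by omega
  unfold eisNorm
  rcases hx with hx | hx | hx <;> rcases hy with hy | hy | hy <;>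
    simp [pow_two, Int.add_emod, Int.mul_emod, hx, hy]

theorem emod_three_eq_of_eisNorm_emod_three_eq_zero {x y : ℤ} (h : eisNorm x y % 3 = 0) :
    x % 3 = y % 3 := by
  have hx : x % 3 = 0 ∨ x % 3 = 1 ∨ x % 3 = 2 := by omega
  have hy : y % 3 = 0 ∨ y % 3 = 1 ∨ y % 3 = 2 := by omega
  unfold eisNorm at h
  rcases hx with hx | hx | hx <;> rcases hy with hy | hy | hy <;>
    simp [pow_two, Int.add_emod, Int.mul_emod, hx, hy] at h ⊢

theorem eisNorm_emod_nine_ne_six (x y : ℤ) : eisNorm x y % 9 ≠ 6 := by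
  intro h
  have h3 := emod_three_eq_of_eisNorm_emod_three_eq_zero (x := x) (y := y) (by omega)
  obtain ⟨t, rfl⟩ : ∃ t, x = y + 3 * t := ⟨(x - y) / 3, by omega⟩
  have e : eisNorm (y + 3 * t) y = 3 * (y ^ 2) + 9 * (y * t + t ^ 2) := by
    unfold eisNorm; ring
  have hy : y ^ 2 % 3 = 0 ∨ y ^ 2 % 3 = 1 := by
    have hy : y % 3 = 0 ∨ y % 3 = 1 ∨ y % 3 = 2 := by omega
    rcases hy with hy | hy | hy <;> simp [pow_two, Int.mul_emod, hy]
  omega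

/-- An Eisenstein integer prime to `√-3` is associated to one congruent to `1` modulo `3`. -/
theorem exists_eisNorm_eq_of_emod_three_eq_one {x y : ℤ} (h : eisNorm x y % 3 = 1) :
    ∃ s t : ℤ, eisNorm (1 + 3 * s) (3 * t) = eisNorm x y := by
  have key : ∀ u v : ℤ, u % 3 = 1 → v % 3 = 0 → eisNorm u v = eisNorm x y →
      ∃ s t : ℤ, eisNorm (1 + 3 * s) (3 * t) = eisNorm x y := by
    intro u v hu hv huv
    refine ⟨u / 3, v / 3, ?_⟩
    rw [← huv]
    congr 1 <;> omega
  have hx : x % 3 = 0 ∨ x % 3 = 1 ∨ x % 3 = 2 := by omega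
  have hy : y % 3 = 0 ∨ y % 3 = 1 ∨ y % 3 = 2 := by omega
  rcases hx with hx | hx | hx <;> rcases hy with hy | hy | hy
  · simp [eisNorm, pow_two, Int.add_emod, Int.mul_emod, hx, hy] at h
  · exact key (x + y) (-x) (by omega) (by omega) (by unfold eisNorm; ring)
  · exact key (-(x + y)) x (by omega) (by omega) (by unfold eisNorm; ring)
  · exact key x y hx hy rfl
  · simp [eisNorm, pow_two, Int.add_emod, Int.mul_emod, hx, hy] at h
  · exact key (-y) (x + y) (by omega) (by omega) (by unfold eisNorm; ring)
  · exact key (-x) (-y) (by omega) (by omega) (by unfold eisNorm; ring)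
  · exact key y (-(x + y)) (by omega) (by omega) (by unfold eisNorm; ring)
  · simp [eisNorm, pow_two, Int.add_emod, Int.mul_emod, hx, hy] at h

/-- The composition identity `(N a + k N b) (N c + k N d) = N (a c̄ + k b d̄) + k N (a d - b c)`. -/
theorem eisNorm_composition (k a₁ a₂ b₁ b₂ c₁ c₂ d₁ d₂ : ℤ) :
    (eisNorm a₁ a₂ + k * eisNorm b₁ b₂) * (eisNorm c₁ c₂ + k * eisNorm d₁ d₂) =
      eisNorm (a₁ * c₁ + a₁ * c₂ + a₂ * c₂ + k * (b₁ * d₁ + b₁ * d₂ + b₂ * d₂))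
          (a₂ * c₁ - a₁ * c₂ + k * (b₂ * d₁ - b₁ * d₂)) +
        k * eisNorm (a₁ * d₁ - a₂ * d₂ - (b₁ * c₁ - b₂ * c₂))
          (a₁ * d₂ + a₂ * d₁ + a₂ * d₂ - (b₁ * c₂ + b₂ * c₁ + b₂ * c₂)) := by
  unfold eisNorm; ring

theorem EisRep.mul {k m n : ℤ} (hm : EisRep k m) (hn : EisRep k n) : EisRep k (m * n) := by
  obtain ⟨a₁, a₂, b₁, b₂, rfl⟩ := hm
  obtain ⟨c₁, c₂, d₁, d₂, rfl⟩ := hn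
  exact ⟨_, _, _, _, (eisNorm_composition k a₁ a₂ b₁ b₂ c₁ c₂ d₁ d₂).symm⟩

theorem eisNorm_mul_left (m x y : ℤ) : eisNorm (m * x) (m * y) = m ^ 2 * eisNorm x y := by
  unfold eisNorm; ring

theorem exists_abs_two_mul_sub_le {m : ℤ} (hm : 0 < m) (x e : ℤ) :
    ∃ q : ℤ, |2 * (x - m * q) + e| ≤ m := by
  refine ⟨(2 * x + e + m) / (2 * m), ?_⟩
  have h1 := Int.emod_add_mul_ediv (2 * x + e + m) (2 * m)
  have h2 := Int.emod_nonneg (2 * x + e + m) (show 2 * m ≠ 0 by omega)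
  have h3 := Int.emod_lt_of_pos (2 * x + e + m) (show 0 < 2 * m by omega)
  rw [abs_le]
  constructor <;> linarith

theorem exists_eisNorm_sub_mul_le {m : ℤ} (hm : 0 < m) (x y : ℤ) :
    ∃ q r : ℤ, 16 * eisNorm (x - m * q) (y - m * r) ≤ 7 * m ^ 2 := by
  obtain ⟨r, hr⟩ := exists_abs_two_mul_sub_le hm y 0
  obtain ⟨q, hq⟩ := exists_abs_two_mul_sub_le hm x (y - m * r)
  refine ⟨q, r, ?_⟩
  have h1 := sq_le_sq' (abs_le.1 hr).1 (abs_le.1 hr).2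
  have h2 := sq_le_sq' (abs_le.1 hq).1 (abs_le.1 hq).2
  unfold eisNorm
  nlinarith

theorem EisRep.descent {k : ℤ} (hk : 0 ≤ k) (hk1 : k ≤ 1) {p : ℕ} (hp : p.Prime) {m : ℤ}
    (h1 : 1 < m) (hmp : m < p) (h : EisRep k (m * p)) :
    ∃ m' : ℤ, 0 < m' ∧ m' < m ∧ EisRep k (m' * p) := by
  obtain ⟨a₁, a₂, b₁, b₂, h⟩ := h
  have hm : 0 < m := by omega
  obtain ⟨q₁, q₂, hq⟩ := exists_eisNorm_sub_mul_le hm a₁ a₂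
  obtain ⟨r₁, r₂, hr⟩ := exists_eisNorm_sub_mul_le hm b₁ b₂
  obtain ⟨c₁, hc₁⟩ : ∃ c, c = a₁ - m * q₁ := ⟨_, rfl⟩
  obtain ⟨c₂, hc₂⟩ : ∃ c, c = a₂ - m * q₂ := ⟨_, rfl⟩
  obtain ⟨d₁, hd₁⟩ : ∃ c, c = b₁ - m * r₁ := ⟨_, rfl⟩
  obtain ⟨d₂, hd₂⟩ : ∃ c, c = b₂ - m * r₂ := ⟨_, rfl⟩
  rw [← hc₁, ← hc₂] at hq
  rw [← hd₁, ← hd₂] at hr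
  obtain rfl : a₁ = c₁ + m * q₁ := by linarith
  obtain rfl : a₂ = c₂ + m * q₂ := by linarith
  obtain rfl : b₁ = d₁ + m * r₁ := by linarith
  obtain rfl : b₂ = d₂ + m * r₂ := by linarith
  have hc0 := eisNorm_nonneg c₁ c₂
  have hd0 := eisNorm_nonneg d₁ d₂
  have hm2 : 0 < m ^ 2 := by positivity
  obtain ⟨m', hm'⟩ : ∃ m', eisNorm c₁ c₂ + k * eisNorm d₁ d₂ = m * m' := by
    refine ⟨p - (2 * c₁ * q₁ + c₁ * q₂ + c₂ * q₁ + 2 * c₂ * q₂ + m * eisNorm q₁ q₂) -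
      k * (2 * d₁ * r₁ + d₁ * r₂ + d₂ * r₁ + 2 * d₂ * r₂ + m * eisNorm r₁ r₂), ?_⟩
    unfold eisNorm at h ⊢
    linear_combination h
  have hkd : 0 ≤ k * eisNorm d₁ d₂ := mul_nonneg hk hd0
  have hkd' : k * eisNorm d₁ d₂ ≤ eisNorm d₁ d₂ := by nlinarith
  have hlt : m' < m := by nlinarith
  have hge : 0 ≤ m' := by nlinarith
  have hne : m' ≠ 0 := by
    rintro rfl
    rw [mul_zero] at hm'
    obtain ⟨rfl, rfl⟩ := eq_zero_of_eisNorm_eq_zero (show eisNorm c₁ c₂ = 0 by linarith)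
    have hkd0 : k * eisNorm d₁ d₂ = 0 := by linarith
    have hdvd : m ∣ p := by
      rcases mul_eq_zero.1 hkd0 with rfl | h0
      · refine ⟨eisNorm q₁ q₂, ?_⟩
        apply mul_left_cancel₀ hm.ne'
        rw [← h]
        unfold eisNorm; ring
      · obtain ⟨rfl, rfl⟩ := eq_zero_of_eisNorm_eq_zero h0
        refine ⟨eisNorm q₁ q₂ + k * eisNorm r₁ r₂, ?_⟩
        apply mul_left_cancel₀ hm.ne'
        rw [← h]
        unfold eisNorm; ring
    have h2 : m.toNat ∣ p := by
      rw [← Int.natCast_dvd_natCast, Int.toNat_of_nonneg hm.le]; exact hdvd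
    rcases (Nat.dvd_prime hp).1 h2 with h3 | h3 <;> omega
  refine ⟨m', by omega, hlt, ?_⟩
  have hcomp := eisNorm_composition k (c₁ + m * q₁) (c₂ + m * q₂) (d₁ + m * r₁) (d₂ + m * r₂)
    c₁ c₂ d₁ d₂
  rw [h, hm'] at hcomp
  refine ⟨m' + (q₁ * c₁ + q₁ * c₂ + q₂ * c₂ + k * (r₁ * d₁ + r₁ * d₂ + r₂ * d₂)),
    q₂ * c₁ - q₁ * c₂ + k * (r₂ * d₁ - r₁ * d₂),
    q₁ * d₁ - q₂ * d₂ - (r₁ * c₁ - r₂ * c₂),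
    q₁ * d₂ + q₂ * d₁ + q₂ * d₂ - (r₁ * c₂ + r₂ * c₁ + r₂ * c₂), ?_⟩
  apply mul_left_cancel₀ hm2.ne'
  rw [show m ^ 2 * (m' * (p : ℤ)) = m * p * (m * m') by ring, hcomp, mul_add,
    mul_left_comm (m ^ 2) k, ← eisNorm_mul_left, ← eisNorm_mul_left, mul_add m m', ← hm']
  congr 2
  · unfold eisNorm; ring
  · ring
  · congr 1 <;> ring

theorem EisRep.of_mul_prime {k : ℤ} (hk : 0 ≤ k) (hk1 : k ≤ 1) {p : ℕ} (hp : p.Prime) (m : ℕ)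
    (h0 : 0 < m) (hmp : m < p) (h : EisRep k (m * p)) : EisRep k p := by
  induction m using Nat.strong_induction_on with
  | _ m ih =>
    rcases Nat.lt_or_ge 1 m with h1 | h1
    · obtain ⟨m', h0', hlt, h'⟩ := h.descent hk hk1 hp (by exact_mod_cast h1)
        (by exact_mod_cast hmp)
      lift m' to ℕ using h0'.le
      exact ih m' (by omega) (by omega) (by omega) h'
    · obtain rfl : m = 1 := by omega
      simpa using h

theorem EisRep.of_dvd {k : ℤ} (hk : 0 ≤ k) (hk1 : k ≤ 1) {p : ℕ} (hp : p.Prime) {n : ℤ}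
    (h0 : 0 < n) (hlt : n < (p : ℤ) ^ 2) (hdvd : (p : ℤ) ∣ n) (h : EisRep k n) :
    EisRep k p := by
  obtain ⟨m, rfl⟩ := hdvd
  have hp0 : (0 : ℤ) < p := by exact_mod_cast hp.pos
  have hm : 0 < m := by nlinarith
  have hm' : m < p := by nlinarith
  lift m to ℕ using hm.le
  exact of_mul_prime hk hk1 hp m (by omega) (by omega) (by rwa [mul_comm])

theorem exists_intCast_eq_two_mul_abs_lt {p : ℕ} (hp : p.Prime) (h2 : p ≠ 2) (x : ZMod p) :
    ∃ a : ℤ, (a : ZMod p) = x ∧ 2 * |a| < p := by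
  have := Fact.mk hp
  refine ⟨x.valMinAbs, x.coe_valMinAbs, ?_⟩
  have h := x.natAbs_valMinAbs_le
  have hodd := hp.eq_two_or_odd
  rw [Int.abs_eq_natAbs]
  omega

theorem EisRep.one_prime {p : ℕ} (hp : p.Prime) : EisRep 1 p := by
  have := Fact.mk hp
  rcases eq_or_ne p 2 with rfl | h2
  · exact ⟨1, 0, 1, 0, by norm_num [eisNorm]⟩
  obtain ⟨x, y, hxy⟩ := FiniteField.exists_root_sum_quadratic (R := ZMod p)
    (f := Polynomial.X ^ 2 + Polynomial.X + 1) (g := Polynomial.X ^ 2)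
    (by compute_degree!) (by compute_degree!)
    (by rw [ZMod.card]; exact hp.eq_two_or_odd.resolve_left h2)
  simp only [Polynomial.eval_add, Polynomial.eval_pow, Polynomial.eval_X,
    Polynomial.eval_one] at hxy
  obtain ⟨a, rfl, ha⟩ := exists_intCast_eq_two_mul_abs_lt hp h2 x
  obtain ⟨b, rfl, hb⟩ := exists_intCast_eq_two_mul_abs_lt hp h2 y
  have hp3 : 3 ≤ p := by have := hp.two_le; omega
  have hp3' : (3 : ℤ) ≤ p := by exact_mod_cast hp3
  refine of_dvd zero_le_one le_rfl hp (n := a ^ 2 + a + 1 + b ^ 2) ?_ ?_ ?_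
    ⟨a, 1, b, 0, by unfold eisNorm; ring⟩
  · nlinarith [sq_nonneg (2 * a + 1), sq_nonneg b]
  · have ha' := abs_lt.1 (show |2 * a| < p by rw [abs_mul]; simpa using ha)
    have hb' := abs_lt.1 (show |2 * b| < p by rw [abs_mul]; simpa using hb)
    have h3 := sq_lt_sq' ha'.1 ha'.2
    have h4 := sq_lt_sq' hb'.1 hb'.2
    nlinarith
  · rw [← ZMod.intCast_zmod_eq_zero_iff_dvd]
    push_cast
    exact hxy

theorem EisRep.zero_prime {p : ℕ} (hp : p.Prime) (h1 : p % 3 = 1) : EisRep 0 p := by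
  have := Fact.mk hp
  have h2 : p ≠ 2 := by omega
  obtain ⟨u, hu⟩ := exists_prime_orderOf_dvd_card (G := (ZMod p)ˣ) 3 (by
    rw [ZMod.card_units]; omega)
  obtain ⟨a, ha, hap⟩ := exists_intCast_eq_two_mul_abs_lt hp h2 (u : ZMod p)
  have hu3 : (u : ZMod p) ^ 3 = 1 := by
    have := pow_orderOf_eq_one u
    rw [hu] at this
    simpa using congrArg Units.val this
  have hu1 : (u : ZMod p) - 1 ≠ 0 := by
    intro h
    have : u = 1 := Units.ext (by simpa using sub_eq_zero.1 h)
    simp [this] at hu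
  have hq : (u : ZMod p) ^ 2 + u + 1 = 0 := by
    apply (mul_eq_zero.1 (show ((u : ZMod p) - 1) * (u ^ 2 + u + 1) = 0 by
      linear_combination hu3)).resolve_left hu1
  have hp3' : (3 : ℤ) ≤ p := by have := hp.two_le; omega
  refine of_dvd le_rfl zero_le_one hp (n := a ^ 2 + a + 1) ?_ ?_ ?_
    ⟨a, 1, 0, 0, by unfold eisNorm; ring⟩
  · nlinarith [sq_nonneg (2 * a + 1)]
  · have ha' := abs_lt.1 (show |2 * a| < p by rw [abs_mul]; simpa using hap)
    have h3 := sq_lt_sq' ha'.1 ha'.2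
    nlinarith
  · rw [← ZMod.intCast_zmod_eq_zero_iff_dvd]
    push_cast
    rw [ha]
    exact hq

/-- The form `⟨1, 1⟩` is universal. -/
theorem EisRep.one_natCast (n : ℕ) : EisRep 1 n := by
  induction n using induction_on_primes with
  | zero => exact ⟨0, 0, 0, 0, by simp [eisNorm]⟩
  | one => exact ⟨1, 0, 0, 0, by simp [eisNorm]⟩
  | prime_mul p a hp ih =>
    push_cast
    exact (one_prime hp).mul ih

theorem EisRep.zero_natCast {n : ℕ} (h0 : n ≠ 0)
    (h : ∀ p : ℕ, p.Prime → p ∣ n → p % 3 = 1) : EisRep 0 n := by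
  induction n using induction_on_primes with
  | zero => exact absurd rfl h0
  | one => exact ⟨1, 0, 0, 0, by simp [eisNorm]⟩
  | prime_mul p a hp ih =>
    push_cast
    exact (zero_prime hp (h p hp (dvd_mul_right p a))).mul
      (ih (right_ne_zero_of_mul h0) fun q hq hqa => h q hq (hqa.mul_left p))

/-- A number congruent to `2` modulo `3` is `N a + N b` with `a ≡ b ≡ 1` modulo `3`. -/
theorem exists_eisNorm_add_eisNorm_of_emod_three_eq_two {n : ℕ} (h : n % 3 = 2) :
    ∃ s t u v : ℤ, eisNorm (1 + 3 * s) (3 * t) + eisNorm (1 + 3 * u) (3 * v) = n := by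
  obtain ⟨a₁, a₂, b₁, b₂, hab⟩ := EisRep.one_natCast n
  have ha := eisNorm_emod_three a₁ a₂
  have hb := eisNorm_emod_three b₁ b₂
  obtain ⟨s, t, hst⟩ :=
    exists_eisNorm_eq_of_emod_three_eq_one (x := a₁) (y := a₂) (by omega)
  obtain ⟨u, v, huv⟩ :=
    exists_eisNorm_eq_of_emod_three_eq_one (x := b₁) (y := b₂) (by omega)
  exact ⟨s, t, u, v, by omega⟩

theorem EisRep.nine_mul {m n : ℕ} (hm : m % 3 = 2) (hn : n % 3 = 2) :
    EisRep 9 (m * n) := by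
  obtain ⟨s, t, u, v, h⟩ := exists_eisNorm_add_eisNorm_of_emod_three_eq_two hm
  obtain ⟨s', t', u', v', h'⟩ := exists_eisNorm_add_eisNorm_of_emod_three_eq_two hn
  have hcomp := eisNorm_composition 1 (1 + 3 * s) (3 * t) (1 + 3 * u) (3 * v)
    (1 + 3 * s') (3 * t') (1 + 3 * u') (3 * v')
  rw [one_mul, one_mul, h, h', one_mul (eisNorm _ _),
    show (1 + 3 * s) * (1 + 3 * u') - 3 * t * (3 * v') -
      ((1 + 3 * u) * (1 + 3 * s') - 3 * v * (3 * t')) =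
      3 * (s + u' + 3 * s * u' - 3 * t * v' - (u + s' + 3 * u * s' - 3 * v * t')) by ring,
    show (1 + 3 * s) * (3 * v') + 3 * t * (1 + 3 * u') + 3 * t * (3 * v') -
      ((1 + 3 * u) * (3 * t') + 3 * v * (1 + 3 * s') + 3 * v * (3 * t')) =
      3 * ((1 + 3 * s) * v' + t * (1 + 3 * u') + 3 * t * v' -
        ((1 + 3 * u) * t' + v * (1 + 3 * s') + 3 * v * t')) by ring,
    eisNorm_mul_left, show (3 : ℤ) ^ 2 = 9 by norm_num] at hcomp
  exact ⟨_, _, _, _, hcomp.symm⟩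

theorem EisRep.nine_of_mod_three_eq_one {n : ℕ} (h : n % 3 = 1) : EisRep 9 n := by
  by_cases hd : ∃ p, p ∣ n ∧ p % 3 = 2
  · obtain ⟨p, ⟨m, rfl⟩, hp⟩ := hd
    have hm : m % 3 = 2 := by
      have hm : m % 3 = 0 ∨ m % 3 = 1 ∨ m % 3 = 2 := by omega
      rcases hm with hm | hm | hm <;> simp [Nat.mul_mod, hp, hm] at h ⊢
    push_cast
    exact nine_mul hp hm
  · push Not at hd
    obtain ⟨a₁, a₂, b₁, b₂, hab⟩ := zero_natCast (n := n) (by omega) (by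
      intro p _ hpn
      have := hd p hpn
      have h3 : p % 3 ≠ 0 := fun h3 => by
        have := (Nat.dvd_of_mod_eq_zero h3).trans hpn
        omega
      omega)
    exact ⟨a₁, a₂, 0, 0, by simpa [eisNorm] using hab⟩

theorem EisRep.nine_mul_nine (n : ℕ) : EisRep 9 (9 * n) := by
  obtain ⟨a₁, a₂, b₁, b₂, h⟩ := EisRep.one_natCast n
  refine ⟨3 * a₁, 3 * a₂, b₁, b₂, ?_⟩
  rw [eisNorm_mul_left]
  linarith

theorem EisRep.nine_three_mul {n : ℕ} (h : n % 3 = 1) : EisRep 9 (3 * n) := by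
  have key : ∀ a₁ a₂ b₁ b₂ : ℤ, eisNorm a₁ a₂ + eisNorm b₁ b₂ = n → eisNorm b₁ b₂ % 3 = 0 →
      EisRep 9 (3 * n) := by
    intro a₁ a₂ b₁ b₂ hab hb
    have hb' := emod_three_eq_of_eisNorm_emod_three_eq_zero hb
    obtain ⟨t, rfl⟩ : ∃ t, b₁ = b₂ + 3 * t := ⟨(b₁ - b₂) / 3, by omega⟩
    refine ⟨-a₁ - 2 * a₂, 2 * a₁ + a₂, b₂ + t, -b₂ - 2 * t, ?_⟩
    rw [← hab]
    unfold eisNorm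
    ring
  obtain ⟨a₁, a₂, b₁, b₂, hab⟩ := EisRep.one_natCast n
  rw [one_mul] at hab
  rcases eisNorm_emod_three b₁ b₂ with hb | hb
  · exact key a₁ a₂ b₁ b₂ hab hb
  · exact key b₁ b₂ a₁ a₂ (by omega) (by omega)

theorem stmt_6 (n : ℤ) (hn : 0 ≤ n) :
    (∃ x1 x2 y1 y2 : ℤ, x1^2 + x1*x2 + x2^2 + 9*y1^2 + 9*y1*y2 + 9*y2^2 = n) ↔
    (n % 3 = 1 ∨ n % 9 = 0 ∨ n % 9 = 3) := by
  constructor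
  · rintro ⟨x1, x2, y1, y2, h⟩
    have hn' : eisNorm x1 x2 + 9 * eisNorm y1 y2 = n := by
      rw [← h]; unfold eisNorm; ring
    have h3 := eisNorm_emod_three x1 x2
    have h9 := eisNorm_emod_nine_ne_six x1 x2
    omega
  · intro h
    suffices hrep : EisRep 9 n by
      obtain ⟨x1, x2, y1, y2, hx⟩ := hrep
      exact ⟨x1, x2, y1, y2, by rw [← hx]; unfold eisNorm; ring⟩
    lift n to ℕ using hn
    rcases h with h | h | h
    · exact EisRep.nine_of_mod_three_eq_one (by omega)
    · obtain ⟨m, rfl⟩ : ∃ m, n = 9 * m := ⟨n / 9, by omega⟩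
      exact_mod_cast EisRep.nine_mul_nine m
    · obtain ⟨m, rfl⟩ : ∃ m, n = 3 * m := ⟨n / 3, by omega⟩
      exact_mod_cast EisRep.nine_three_mul (n := m) (by omega)
end

section
/- A nonnegative integer n is represented by the quaternary quadratic form x₁² + x₁x₂ + x₂² + 12y₁² + 12y₁y₂ + 12y₂² if and only if n ≡ 0, 1, 3, 4, 7 or 9 (mod 12). (This is the regularity of the binary Hermitian lattice ⟨1,12⟩ over ℚ(√-3), stated for its associated quadratic form.) -/
open QuadraticAlgebra

/-- The Eisenstein integers `ℤ[ω]`, where `ω ^ 2 = ω - 1`. -/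
abbrev EisensteinInt := QuadraticAlgebra ℤ (-1) 1

namespace EisensteinInt

theorem norm_eq (z : EisensteinInt) : norm z = z.re ^ 2 + z.re * z.im + z.im ^ 2 := by
  rw [norm_def]; ring

theorem norm_nonneg (z : EisensteinInt) : 0 ≤ norm z := by
  rw [norm_eq]; nlinarith [sq_nonneg (z.re + z.im), sq_nonneg z.re, sq_nonneg z.im]

theorem eq_zero_of_norm_eq_zero {z : EisensteinInt} (h : norm z = 0) : z = 0 := by
  rw [norm_eq] at h
  have h1 : z.re ^ 2 = 0 := by
    nlinarith [sq_nonneg (z.re + z.im), sq_nonneg z.re, sq_nonneg z.im]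
  have h2 : z.im ^ 2 = 0 := by
    nlinarith [sq_nonneg (z.re + z.im), sq_nonneg z.re, sq_nonneg z.im]
  ext
  · exact pow_eq_zero_iff two_ne_zero |>.1 h1
  · exact pow_eq_zero_iff two_ne_zero |>.1 h2

/-- Multiplicativity of the norm of the quaternion order `ℤ[ω] + ℤ[ω] j`, `j ^ 2 = -1`. -/
theorem norm_add_norm_mul (x y z w : EisensteinInt) :
    norm (x * z - y * star w) + norm (x * w + y * star z) =
      (norm x + norm y) * (norm z + norm w) := by
  simp only [norm_eq, re_add, im_add, re_sub, im_sub, re_mul, im_mul, re_star, im_star]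
  ring

theorem exists_shifted_bmod {m c : ℤ} (hm : 0 < m) (hc : -m ≤ c) (hc' : c ≤ m) (a : ℤ) :
    ∃ q r : ℤ, a = r + m * q ∧ -m ≤ 2 * r + c ∧ 2 * r + c ≤ m := by
  have h1 := Int.emod_add_mul_ediv a m
  have h2 := Int.emod_nonneg a hm.ne'
  have h3 := Int.emod_lt_of_pos a hm
  by_cases h : 2 * (a % m) + c ≤ m
  · exact ⟨a / m, a % m, by linarith, by linarith, h⟩
  · exact ⟨a / m + 1, a % m - m, by linarith, by linarith, by linarith⟩

theorem exists_bmod {m : ℤ} (hm : 0 < m) (a : ℤ) :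
    ∃ q r : ℤ, a = r + m * q ∧ -m ≤ 2 * r ∧ 2 * r ≤ m := by
  simpa using exists_shifted_bmod (c := 0) hm (by linarith) hm.le a

theorem exists_small_remainder (m : ℤ) (hm : 0 < m) (z : EisensteinInt) :
    ∃ q r : EisensteinInt, z = r + (m : EisensteinInt) * q ∧ 16 * norm r ≤ 7 * m ^ 2 ∧
      (z = 0 → q = 0 ∧ r = 0) := by
  by_cases hz : z = 0
  · exact ⟨0, 0, by simp [hz], by simp; positivity, by simp⟩
  obtain ⟨q₂, s, hs, hs1, hs2⟩ := exists_bmod hm z.im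
  obtain ⟨q₁, t, ht, ht1, ht2⟩ :=
    exists_shifted_bmod (c := s) hm (by linarith) (by linarith) z.re
  refine ⟨⟨q₁, q₂⟩, ⟨t, s⟩, ?_, ?_, fun h => absurd h hz⟩
  · ext <;> simp [ht, hs]
  · rw [norm_eq]
    have h1 : (2 * s) ^ 2 ≤ m ^ 2 := sq_le_sq' hs1 hs2
    have h2 : (2 * t + s) ^ 2 ≤ m ^ 2 := sq_le_sq' ht1 ht2
    simp only
    nlinarith

theorem descent_step {p m : ℤ} (hm : 1 < m) (hmp : ¬ m ∣ p) {x y : EisensteinInt}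
    (h : norm x + norm y = m * p) :
    ∃ (m' : ℤ) (x' y' : EisensteinInt), 0 < m' ∧ m' < m ∧ norm x' + norm y' = m' * p ∧
      (y = 0 → y' = 0) := by
  obtain ⟨q, r, hx, hr, -⟩ := exists_small_remainder m (by linarith) x
  obtain ⟨t, s, hy, hs, hy0⟩ := exists_small_remainder m (by linarith) y
  obtain ⟨k, hk⟩ : m ∣ norm r + norm s := by
    refine ⟨p - (2 * r.re * q.re + r.re * q.im + r.im * q.re + 2 * r.im * q.im +
      m * norm q + (2 * s.re * t.re + s.re * t.im + s.im * t.re + 2 * s.im * t.im +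
      m * norm t)), ?_⟩
    rw [mul_sub, ← h, hx, hy]
    simp only [norm_eq, re_add, im_add, re_mul, im_mul, re_intCast, im_intCast,
      Int.cast_id]
    ring
  have hk0 : 0 ≤ k := by
    have := norm_nonneg r
    have := norm_nonneg s
    by_contra! hneg
    nlinarith
  have hkm : k < m := by nlinarith
  have key : norm ((k : EisensteinInt) + q * star r + t * star s) + norm (t * r - q * s) =
      k * p := by
    have h1 := norm_add_norm_mul x y (star r) (-s)
    have e1 : x * star r - y * star (-s) =
        (m : EisensteinInt) * (k + q * star r + t * star s) := by
      have h2 : r * star r + s * star s = (m : EisensteinInt) * k := by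
        have := congrArg (algebraMap ℤ EisensteinInt) hk
        rw [map_add, map_mul, algebraMap_norm_eq_mul_star, algebraMap_norm_eq_mul_star] at this
        simpa using this
      rw [hx, hy, star_neg]
      linear_combination h2
    have e2 : x * -s + y * star (star r) = (m : EisensteinInt) * (t * r - q * s) := by
      rw [hx, hy, star_star]; ring
    rw [e1, e2, map_mul, map_mul, norm_intCast,
      QuadraticAlgebra.norm_star, QuadraticAlgebra.norm_neg, hk, h] at h1
    have hm2 : m ^ 2 ≠ 0 := by positivity
    apply mul_left_cancel₀ hm2
    linear_combination h1
  have hkne : k ≠ 0 := by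
    rintro rfl
    have hr0 : r = 0 := eq_zero_of_norm_eq_zero (by
      linarith [norm_nonneg r, norm_nonneg s])
    have hs0 : s = 0 := eq_zero_of_norm_eq_zero (by
      linarith [norm_nonneg r, norm_nonneg s])
    apply hmp
    refine ⟨norm q + norm t, ?_⟩
    rw [hx, hy, hr0, hs0, zero_add, zero_add, map_mul, map_mul, norm_intCast] at h
    apply mul_left_cancel₀ (by linarith : m ≠ 0)
    linear_combination -h
  refine ⟨k, _, _, by omega, hkm, key, fun h0 => ?_⟩
  obtain ⟨rfl, rfl⟩ := hy0 h0
  obtain rfl : y = 0 := h0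
  simp

theorem exists_norm_add_norm_of_multiple {p : ℕ} (hp : p.Prime) (m : ℕ) (hm0 : 0 < m)
    (hmp : m < p) (x y : EisensteinInt) (h : norm x + norm y = m * p) :
    ∃ x' y' : EisensteinInt, norm x' + norm y' = p ∧ (y = 0 → y' = 0) := by
  induction m using Nat.strong_induction_on generalizing x y with
  | _ m ih =>
    rcases (by omega : m = 1 ∨ 1 < m) with rfl | hm
    · exact ⟨x, y, by simpa using h, id⟩
    · have hdvd : ¬ (m : ℤ) ∣ p := by
        rw [Int.natCast_dvd_natCast, hp.dvd_iff_eq (by omega)]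
        omega
      obtain ⟨k, x', y', hk0, hkm, hk, hy⟩ := descent_step (by exact_mod_cast hm) hdvd h
      lift k to ℕ using hk0.le
      obtain ⟨x'', y'', h1, h2⟩ := ih k (by omega) (by omega) (by omega) x' y' hk
      exact ⟨x'', y'', h1, h2 ∘ hy⟩

/-- A multiple of `p` that is small and positive starts the descent. -/
theorem exists_norm_add_norm_of_dvd {p : ℕ} (hp : p.Prime) {x y : EisensteinInt}
    (hdvd : (p : ℤ) ∣ norm x + norm y) (hpos : 0 < norm x + norm y)
    (hlt : norm x + norm y < p ^ 2) :
    ∃ x' y' : EisensteinInt, norm x' + norm y' = p ∧ (y = 0 → y' = 0) := by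
  obtain ⟨k, hk⟩ := hdvd
  have hp0 : (0 : ℤ) < p := by exact_mod_cast hp.pos
  have hk0 : 0 < k := by
    by_contra! hneg
    nlinarith
  have hkp : k < p := by nlinarith
  lift k to ℕ using hk0.le
  exact exists_norm_add_norm_of_multiple hp k (by omega) (by omega) x y (by rw [hk, mul_comm])

theorem prime_eq_norm_add_norm {p : ℕ} (hp : p.Prime) :
    ∃ x y : EisensteinInt, norm x + norm y = p := by
  rcases hp.eq_two_or_odd with rfl | hodd
  · exact ⟨1, 1, by simp⟩
  have : Fact p.Prime := ⟨hp⟩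
  have hp2 : 2 < p := by have := hp.two_le; omega
  obtain ⟨u, v, huv⟩ := ZMod.sq_add_sq p (-3)
  have h2 : (2 : ZMod p) ≠ 0 := by
    have : ((2 : ℕ) : ZMod p) ≠ 0 := by
      rw [Ne, ZMod.natCast_eq_zero_iff, Nat.dvd_prime Nat.prime_two]
      omega
    exact_mod_cast this
  have hp0 : (0 : ℤ) < p := by omega
  obtain ⟨a₀, ha₀⟩ := ZMod.intCast_surjective (u / 2)
  obtain ⟨b₀, hb₀⟩ := ZMod.intCast_surjective ((v - 1) / 2)
  obtain ⟨qa, a, ha, ha1, ha2⟩ := exists_bmod hp0 a₀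
  obtain ⟨qb, b, hb, hb1, hb2⟩ := exists_bmod hp0 b₀
  have ha' : (2 : ZMod p) * a = u := by
    rw [ha] at ha₀
    simp only [Int.cast_add, Int.cast_mul, Int.cast_natCast, CharP.cast_eq_zero, zero_mul,
      add_zero] at ha₀
    rw [ha₀]; field_simp
  have hb' : (2 : ZMod p) * b = v - 1 := by
    rw [hb] at hb₀
    simp only [Int.cast_add, Int.cast_mul, Int.cast_natCast, CharP.cast_eq_zero, zero_mul,
      add_zero] at hb₀
    rw [hb₀]; field_simp
  have hN : norm (⟨a, 0⟩ : EisensteinInt) + norm (⟨b, 1⟩ : EisensteinInt) =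
      a ^ 2 + (b ^ 2 + b + 1) := by
    simp only [norm_eq]; ring
  have hlow : 0 < a ^ 2 + (b ^ 2 + b + 1) := by nlinarith [sq_nonneg a, sq_nonneg (2 * b + 1)]
  have hhigh : a ^ 2 + (b ^ 2 + b + 1) < (p : ℤ) ^ 2 := by
    have h1 : (2 * a) ^ 2 ≤ (p : ℤ) ^ 2 := sq_le_sq' ha1 ha2
    have h3 : (2 * b) ^ 2 ≤ (p : ℤ) ^ 2 := sq_le_sq' hb1 hb2
    have h4 : (3 : ℤ) ≤ p := by omega
    nlinarith
  obtain ⟨x, y, h, -⟩ := exists_norm_add_norm_of_dvd hp (x := ⟨a, 0⟩) (y := ⟨b, 1⟩)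
    (by
      rw [hN, ← ZMod.intCast_zmod_eq_zero_iff_dvd]
      push_cast
      apply mul_left_cancel₀ (mul_ne_zero h2 h2)
      linear_combination huv + (2 * (a : ZMod p) + u) * ha' +
        (2 * (b : ZMod p) + 1 + v) * hb')
    (by rw [hN]; exact hlow) (by rw [hN]; exact hhigh)
  exact ⟨x, y, h⟩

theorem nat_eq_norm_add_norm (n : ℕ) : ∃ x y : EisensteinInt, norm x + norm y = n := by
  induction n using induction_on_primes with
  | zero => exact ⟨0, 0, by simp⟩
  | one => exact ⟨1, 0, by simp⟩
  | prime_mul p a hp ih =>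
    obtain ⟨x, y, h⟩ := prime_eq_norm_add_norm hp
    obtain ⟨z, w, h'⟩ := ih
    exact ⟨_, _, by rw [norm_add_norm_mul x y z w, h, h']; push_cast; rfl⟩

theorem prime_eq_norm {p : ℕ} (hp : p.Prime) (h3 : p % 3 = 1) :
    ∃ x : EisensteinInt, norm x = p := by
  have : Fact p.Prime := ⟨hp⟩
  have hp2 : 3 < p := by
    have := hp.two_le
    omega
  obtain ⟨u, hu⟩ : ∃ u : (ZMod p)ˣ, orderOf u = 3 := by
    have : Fact (Nat.Prime 3) := ⟨Nat.prime_three⟩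
    apply exists_prime_orderOf_dvd_card 3
    rw [ZMod.card_units]
    omega
  have hu3 : (u : ZMod p) ^ 3 = 1 := by
    rw [← Units.val_pow_eq_pow_val, ← hu, pow_orderOf_eq_one, Units.val_one]
  have hu1 : (u : ZMod p) - 1 ≠ 0 := by
    intro h
    have : u = 1 := Units.ext (by simpa [sub_eq_zero] using h)
    simp [this] at hu
  obtain ⟨b₀, hb₀⟩ := ZMod.intCast_surjective (u : ZMod p)
  obtain ⟨q, b, hb, hb1, hb2⟩ := exists_bmod (m := p) (by omega) b₀
  have hb' : (b : ZMod p) = u := by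
    rw [hb] at hb₀
    simpa using hb₀
  have hN : norm (⟨b, 1⟩ : EisensteinInt) + norm (0 : EisensteinInt) = b ^ 2 + b + 1 := by
    simp only [norm_eq, re_zero, im_zero]; ring
  obtain ⟨x, y, h, hy⟩ := exists_norm_add_norm_of_dvd hp (x := ⟨b, 1⟩) (y := 0)
    (by
      rw [hN, ← ZMod.intCast_zmod_eq_zero_iff_dvd]
      push_cast
      apply mul_left_cancel₀ hu1
      rw [hb']
      linear_combination hu3)
    (by rw [hN]; nlinarith [sq_nonneg (2 * b + 1)])
    (by
      rw [hN]
      have h1 : (2 * b) ^ 2 ≤ (p : ℤ) ^ 2 := sq_le_sq' hb1 hb2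
      have h4 : (3 : ℤ) ≤ p := by omega
      nlinarith)
  refine ⟨x, ?_⟩
  simpa [hy rfl] using h

theorem nat_eq_norm (n : ℕ) (hn : ∀ p : ℕ, p.Prime → p ∣ n → p % 3 = 1) :
    ∃ x : EisensteinInt, norm x = n := by
  induction n using induction_on_primes with
  | zero => exact ⟨0, by simp⟩
  | one => exact ⟨1, by simp⟩
  | prime_mul p a hp ih =>
    obtain ⟨x, hx⟩ := prime_eq_norm hp (hn p hp (dvd_mul_right p a))
    obtain ⟨y, hy⟩ := ih fun q hq hqa => hn q hq (hqa.mul_left p)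
    exact ⟨x * y, by rw [map_mul, hx, hy]; push_cast; rfl⟩

theorem norm_eq_sq_add (z : EisensteinInt) :
    norm z = (z.re - z.im) ^ 2 + 3 * (z.re * z.im) := by
  rw [norm_eq]; ring

theorem norm_emod_three (z : EisensteinInt) : norm z % 3 = 0 ∨ norm z % 3 = 1 := by
  rw [norm_eq_sq_add]
  rcases (by omega : (z.re - z.im) % 3 = 0 ∨ (z.re - z.im) % 3 = 1 ∨ (z.re - z.im) % 3 = 2)
    with h | h | h <;> simp [pow_two, Int.add_emod, Int.mul_emod, h]

theorem three_dvd_norm_iff (z : EisensteinInt) : 3 ∣ norm z ↔ 3 ∣ z.re - z.im := by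
  rw [norm_eq_sq_add, dvd_add_left (dvd_mul_right 3 _)]
  exact Int.prime_three.dvd_pow_iff_dvd two_ne_zero

theorem exists_norm_eq_three_mul {z : EisensteinInt} (h : 3 ∣ norm z) :
    ∃ u : EisensteinInt, norm z = 3 * norm u := by
  obtain ⟨k, hk⟩ := (three_dvd_norm_iff z).1 h
  obtain hre : z.re = z.im + 3 * k := by linarith
  refine ⟨⟨z.im + k, k⟩, ?_⟩
  simp only [norm_eq, hre]
  ring

theorem exists_norm_eq_four_mul {z : EisensteinInt} (h : 2 ∣ norm z) :
    ∃ u : EisensteinInt, norm z = 4 * norm u := by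
  rw [norm_eq] at h
  have h1 : 2 ∣ z.re ∧ 2 ∣ z.im := by
    rcases Int.emod_two_eq_zero_or_one z.re with h1 | h1 <;>
    rcases Int.emod_two_eq_zero_or_one z.im with h2 | h2 <;>
    · have h3 := Int.emod_eq_zero_of_dvd h
      simp [pow_two, Int.add_emod, Int.mul_emod, h1, h2] at h3
      try omega
  obtain ⟨⟨a, ha⟩, ⟨b, hb⟩⟩ := h1
  refine ⟨⟨a, b⟩, ?_⟩
  simp only [norm_eq, ha, hb]
  ring

theorem odd_eq_norm_add_four_mul (n : ℕ) (hn : n % 2 = 1) :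
    ∃ x y : EisensteinInt, norm x + 4 * norm y = n := by
  obtain ⟨x, y, h⟩ := nat_eq_norm_add_norm n
  rcases (by omega : 2 ∣ norm x ∨ 2 ∣ norm y) with h2 | h2
  · obtain ⟨u, hu⟩ := exists_norm_eq_four_mul h2
    exact ⟨y, u, by linarith⟩
  · obtain ⟨u, hu⟩ := exists_norm_eq_four_mul h2
    exact ⟨x, u, by linarith⟩

theorem eq_norm_add_four_mul (n : ℕ) (hn : n % 4 ≠ 2) :
    ∃ x y : EisensteinInt, norm x + 4 * norm y = n := by
  rcases Nat.mod_two_eq_zero_or_one n with h | h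
  · obtain ⟨k, rfl⟩ : 4 ∣ n := by omega
    obtain ⟨x, y, hk⟩ := nat_eq_norm_add_norm k
    refine ⟨(2 : ℤ) * x, y, ?_⟩
    rw [map_mul, norm_intCast]
    push_cast
    linear_combination 4 * hk
  · exact odd_eq_norm_add_four_mul n h

/-- The product of `x + 2yj` or of its conjugate with `z + 2wj` lies in `ℤ[ω] + 2√-3 ℤ[ω] j`. -/
theorem mul_eq_norm_add_twelve_mul {x y z w : EisensteinInt}
    (hxw : norm x * norm w % 3 = 1) (hyz : norm y * norm z % 3 = 1) :
    ∃ s t : EisensteinInt,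
      norm s + 12 * norm t = (norm x + 4 * norm y) * (norm z + 4 * norm w) := by
  have key : 3 ∣ norm (x * w + y * star z) ∨ 3 ∣ norm (star x * w + -y * star z) := by
    rw [three_dvd_norm_iff, three_dvd_norm_iff, ← Int.prime_three.dvd_mul]
    have h1 : 3 ∣ norm x * norm w - norm y * norm z := by omega
    rw [← Int.modEq_zero_iff_dvd] at h1 ⊢
    have hsq (v : EisensteinInt) : norm v ≡ (v.re - v.im) ^ 2 [ZMOD 3] := by
      rw [norm_eq_sq_add, Int.modEq_iff_dvd]
      exact ⟨-(v.re * v.im), by ring⟩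
    have h2 := (((hsq x).mul (hsq w)).sub ((hsq y).mul (hsq z))).symm.trans h1
    refine Int.ModEq.trans ?_ h2
    have e1 : (x * w + y * star z).re - (x * w + y * star z).im ≡
        (x.re - x.im) * (w.re - w.im) + (y.re - y.im) * (z.re - z.im) [ZMOD 3] := by
      simp only [re_add, im_add, re_mul, im_mul, re_star, im_star]
      rw [Int.modEq_iff_dvd]
      exact ⟨x.im * w.im - y.re * z.im, by ring⟩
    have e2 : (star x * w + -y * star z).re - (star x * w + -y * star z).im ≡
        (x.re - x.im) * (w.re - w.im) - (y.re - y.im) * (z.re - z.im) [ZMOD 3] := by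
      simp only [re_add, im_add, re_mul, im_mul, re_star, im_star, re_neg, im_neg]
      rw [Int.modEq_iff_dvd]
      exact ⟨-x.im * w.re + y.re * z.im, by ring⟩
    convert e1.mul e2 using 1
    ring
  have hmul (x y : EisensteinInt) (h : 3 ∣ norm (x * w + y * star z)) :
      ∃ s t : EisensteinInt,
        norm s + 12 * norm t = (norm x + 4 * norm y) * (norm z + 4 * norm w) := by
    obtain ⟨t, ht⟩ := exists_norm_eq_three_mul h
    refine ⟨x * z - (2 : ℤ) * y * star ((2 : ℤ) * w), t, ?_⟩
    have h1 := norm_add_norm_mul x ((2 : ℤ) * y) z ((2 : ℤ) * w)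
    have h2 : x * ((2 : ℤ) * w) + (2 : ℤ) * y * star z =
      ((2 : ℤ) : EisensteinInt) * (x * w + y * star z) := by ring
    rw [h2, map_mul QuadraticAlgebra.norm _ (x * w + y * star z), map_mul QuadraticAlgebra.norm _ y,
      map_mul QuadraticAlgebra.norm _ w, norm_intCast, ht] at h1
    linear_combination h1
  rcases key with h | h
  · exact hmul x y h
  · obtain ⟨s, t, hst⟩ := hmul (star x) (-y) h
    exact ⟨s, t, by rwa [QuadraticAlgebra.norm_star, QuadraticAlgebra.norm_neg] at hst⟩

theorem eq_norm_add_twelve_mul_of_mod_six (n : ℕ) (hn : n % 6 = 1) :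
    ∃ x y : EisensteinInt, norm x + 12 * norm y = n := by
  by_cases hall : ∀ p : ℕ, p.Prime → p ∣ n → p % 3 = 1
  · obtain ⟨x, hx⟩ := nat_eq_norm n hall
    exact ⟨x, 0, by simpa using hx⟩
  push Not at hall
  obtain ⟨p, hp, ⟨m, rfl⟩, hp3⟩ := hall
  have hmod2 : p % 2 * (m % 2) % 2 = 1 := by rw [← Nat.mul_mod]; omega
  have hmod3 : p % 3 * (m % 3) % 3 = 1 := by rw [← Nat.mul_mod]; omega
  obtain ⟨hp2, hm2⟩ : p % 2 = 1 ∧ m % 2 = 1 := by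
    rcases Nat.mod_two_eq_zero_or_one p with h | h <;>
    rcases Nat.mod_two_eq_zero_or_one m with h' | h' <;> simp_all
  obtain ⟨hp3, hm3⟩ : p % 3 = 2 ∧ m % 3 = 2 := by
    rcases (by omega : p % 3 = 0 ∨ p % 3 = 2) with h | h <;>
    rcases (by omega : m % 3 = 0 ∨ m % 3 = 1 ∨ m % 3 = 2) with h' | h' | h' <;> simp_all
  obtain ⟨x, y, hxy⟩ := odd_eq_norm_add_four_mul p hp2
  obtain ⟨z, w, hzw⟩ := odd_eq_norm_add_four_mul m hm2
  have hx := norm_emod_three x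
  have hy := norm_emod_three y
  have hz := norm_emod_three z
  have hw := norm_emod_three w
  obtain ⟨s, t, hst⟩ := mul_eq_norm_add_twelve_mul (x := x) (y := y) (z := z) (w := w)
    (by rw [Int.mul_emod, (by omega : norm x % 3 = 1), (by omega : norm w % 3 = 1)]; rfl)
    (by rw [Int.mul_emod, (by omega : norm y % 3 = 1), (by omega : norm z % 3 = 1)]; rfl)
  exact ⟨s, t, by rw [hst, hxy, hzw]; push_cast; rfl⟩

theorem eq_norm_add_twelve_mul (n : ℕ) (h4 : n % 4 ≠ 2) (h3 : n % 3 ≠ 2) :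
    ∃ x y : EisensteinInt, norm x + 12 * norm y = n := by
  rcases (by omega : n % 3 = 0 ∨ n % 6 = 1 ∨ (n % 3 = 1 ∧ n % 4 = 0)) with h | h | ⟨h, h'⟩
  · obtain ⟨m, rfl⟩ := Nat.dvd_of_mod_eq_zero h
    obtain ⟨x, y, hm⟩ := eq_norm_add_four_mul m (by omega)
    refine ⟨⟨-1, 2⟩ * x, y, ?_⟩
    rw [map_mul, norm_eq ⟨-1, 2⟩]
    push_cast
    linear_combination 3 * hm
  · exact eq_norm_add_twelve_mul_of_mod_six n h
  · obtain ⟨m, rfl⟩ := Nat.dvd_of_mod_eq_zero h'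
    obtain ⟨x, y, hm⟩ := nat_eq_norm_add_norm m
    have hx := norm_emod_three x
    have hy := norm_emod_three y
    wlog h0 : norm y % 3 = 0 generalizing x y
    · exact this y x (by linarith) hy hx (by omega)
    obtain ⟨t, ht⟩ := exists_norm_eq_three_mul (Int.dvd_of_emod_eq_zero h0)
    refine ⟨(2 : ℤ) * x, t, ?_⟩
    rw [map_mul, norm_intCast]
    push_cast
    linear_combination 4 * hm - 4 * ht

theorem norm_emod_four (z : EisensteinInt) : norm z % 4 ≠ 2 := by
  intro h
  obtain ⟨u, hu⟩ := exists_norm_eq_four_mul (z := z) (by omega)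
  omega

end EisensteinInt

open EisensteinInt in
theorem stmt_7 (n : ℤ) (hn : 0 ≤ n) :
    (∃ x1 x2 y1 y2 : ℤ, x1^2 + x1*x2 + x2^2 + 12*y1^2 + 12*y1*y2 + 12*y2^2 = n) ↔
    (n % 12 = 0 ∨ n % 12 = 1 ∨ n % 12 = 3 ∨ n % 12 = 4 ∨ n % 12 = 7 ∨ n % 12 = 9) := by
  constructor
  · rintro ⟨x1, x2, y1, y2, h⟩
    have h' : norm (⟨x1, x2⟩ : EisensteinInt) + 12 * norm (⟨y1, y2⟩ : EisensteinInt) = n := by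
      simp only [norm_eq]; linear_combination h
    have h3 := norm_emod_three ⟨x1, x2⟩
    have h4 := norm_emod_four ⟨x1, x2⟩
    omega
  · intro h
    lift n to ℕ using hn
    obtain ⟨x, y, hxy⟩ := eq_norm_add_twelve_mul n (by omega) (by omega)
    refine ⟨x.re, x.im, y.re, y.im, ?_⟩
    rw [norm_eq, norm_eq] at hxy
    linear_combination hxy
end

section
/- A nonnegative integer n is represented by the quaternary quadratic form x₁² + 5x₂² + 8y₁² + 40y₂² if and only if n ≡ 0 or 1 (mod 4), or n ≡ 6 (mod 8). (This is the regularity of the binary Hermitian lattice ⟨1,8⟩ over ℚ(√-5), stated for its associated quadratic form.) -/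
/-- The integral ternary form `a x² + b y² + c z² + r yz + s xz + t xy` is positive definite,
has half-discriminant `5`, and represents `k`. -/
structure RepresentsDiscFive (k a b c r s t : ℤ) : Prop where
  pos : 0 < a
  minor_pos : 0 < 4 * a * b - t ^ 2
  disc : 4 * a * b * c + r * s * t - a * r ^ 2 - b * s ^ 2 - c * t ^ 2 = 5
  rep : ∃ x y z : ℤ, a * x ^ 2 + b * y ^ 2 + c * z ^ 2 + r * y * z + s * x * z + t * x * y = k

/-- `k` is represented by the positive ternary form `u² + uv + v² + vw + 2w²`
of half-discriminant `5`. -/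
def RepresentedByReduced (k : ℤ) : Prop :=
  ∃ u v w : ℤ, u ^ 2 + u * v + v ^ 2 + v * w + 2 * w ^ 2 = k

theorem exists_shift_mem_Icc (t a : ℤ) (ha : 0 < a) :
    ∃ m : ℤ, -a ≤ t + 2 * a * m ∧ t + 2 * a * m ≤ a := by
  refine ⟨-((t + a) / (2 * a)), ?_, ?_⟩
  · have := Int.mul_ediv_self_le (x := t + a) (k := 2 * a) (by omega)
    linarith
  · have := Int.lt_mul_ediv_self_add (x := t + a) (k := 2 * a) (by omega)
    linarith

namespace RepresentsDiscFive

variable {k a b c r s t : ℤ}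

theorem shift_x_y (h : RepresentsDiscFive k a b c r s t) (m : ℤ) :
    RepresentsDiscFive k a (b + t * m + a * m ^ 2) c (r + s * m) s (t + 2 * a * m) := by
  obtain ⟨h1, h2, h3, x, y, z, h4⟩ := h
  exact ⟨h1, by linarith, by linear_combination h3, x - m * y, y, z, by linear_combination h4⟩

theorem shift_x_z (h : RepresentsDiscFive k a b c r s t) (m : ℤ) :
    RepresentsDiscFive k a b (c + s * m + a * m ^ 2) (r + t * m) (s + 2 * a * m) t := by
  obtain ⟨h1, h2, h3, x, y, z, h4⟩ := h
  exact ⟨h1, h2, by linear_combination h3, x - m * z, y, z, by linear_combination h4⟩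

theorem shift_y_z (h : RepresentsDiscFive k a b c r s t) (m : ℤ) :
    RepresentsDiscFive k a b (c + r * m + b * m ^ 2) (r + 2 * b * m) (s + t * m) t := by
  obtain ⟨h1, h2, h3, x, y, z, h4⟩ := h
  exact ⟨h1, h2, by linear_combination h3, x, y - m * z, z, by linear_combination h4⟩

theorem pos_b (h : RepresentsDiscFive k a b c r s t) : 0 < b := by
  obtain ⟨h1, h2, -, -⟩ := h
  by_contra hb
  nlinarith [mul_nonneg h1.le (not_lt.mp hb |> sub_nonneg.mpr), sq_nonneg t]

theorem swap_x_y (h : RepresentsDiscFive k a b c r s t) :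
    RepresentsDiscFive k b a c s r t := by
  have hb := h.pos_b
  obtain ⟨h1, h2, h3, x, y, z, h4⟩ := h
  exact ⟨hb, by linarith, by linear_combination h3, y, x, z, by linear_combination h4⟩

theorem adjugate (h : RepresentsDiscFive k a b c r s t) :
    (4 * a * b - t ^ 2) * (4 * a * c - s ^ 2) = (2 * a * r - s * t) ^ 2 + 20 * a := by
  linear_combination 4 * a * h.disc

theorem swap_y_z (h : RepresentsDiscFive k a b c r s t) :
    RepresentsDiscFive k a c b r t s := by
  have hadj := h.adjugate
  obtain ⟨h1, h2, h3, x, y, z, h4⟩ := h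
  refine ⟨h1, ?_, by linear_combination h3, x, z, y, by linear_combination h4⟩
  have : 0 < (4 * a * b - t ^ 2) * (4 * a * c - s ^ 2) := by rw [hadj]; positivity
  exact (pos_iff_pos_of_mul_pos this).mp h2

theorem eq_of_bounds_of_disc (hc : 1 ≤ c ∧ c ≤ 2) (hr : -1 ≤ r ∧ r ≤ 1) (hs : -1 ≤ s ∧ s ≤ 1)
    (ht : -1 ≤ t ∧ t ≤ 1) (h : 4 * c + r * s * t - r ^ 2 - s ^ 2 - c * t ^ 2 = 5) :
    c = 2 ∧ t ^ 2 = 1 ∧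
      ((s = 0 ∧ r ^ 2 = 1) ∨ (r = 0 ∧ s ^ 2 = 1) ∨ (r = s * t ∧ s ^ 2 = 1)) := by
  obtain ⟨hc1, hc2⟩ := hc
  obtain ⟨hr1, hr2⟩ := hr
  obtain ⟨hs1, hs2⟩ := hs
  obtain ⟨ht1, ht2⟩ := ht
  interval_cases c <;> interval_cases t <;> interval_cases s <;> interval_cases r <;> omega

/-- A Hermite-reduced form of half-discriminant `5` is equivalent to the reduced one. -/
theorem representedByReduced_of_bounds (h : RepresentsDiscFive k a b c r s t)
    (ht : -a ≤ t ∧ t ≤ a) (hs : -a ≤ s ∧ s ≤ a) (hab : a ≤ b)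
    (hB : -(4 * a * b - t ^ 2) ≤ 2 * (2 * a * r - s * t) ∧
      2 * (2 * a * r - s * t) ≤ 4 * a * b - t ^ 2)
    (hAC : 4 * a * b - t ^ 2 ≤ 4 * a * c - s ^ 2) : RepresentedByReduced k := by
  have hadj := h.adjugate
  obtain ⟨h1, h2, h3, x, y, z, h4⟩ := h
  obtain ⟨ht1, ht2⟩ := ht
  obtain ⟨hs1, hs2⟩ := hs
  obtain ⟨hB1, hB2⟩ := hB
  have hA3 : 3 * a ^ 2 ≤ 4 * a * b - t ^ 2 := by nlinarith
  have hA80 : 3 * (4 * a * b - t ^ 2) ^ 2 ≤ 80 * a := by nlinarith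
  have ha1 : a = 1 := by
    by_contra hne
    have ha2 : 2 ≤ a := by omega
    have hsq : (3 * a ^ 2) ^ 2 ≤ (4 * a * b - t ^ 2) ^ 2 := by gcongr
    have hcube : 8 ≤ a ^ 3 := by nlinarith [sq_nonneg a]
    nlinarith [mul_le_mul_of_nonneg_left hcube h1.le]
  subst ha1
  have hA5 : 4 * b - t ^ 2 ≤ 5 := by nlinarith
  have htsq : t ^ 2 ≤ 1 := by nlinarith
  have hb1 : b = 1 := by omega
  subst hb1
  have hssq : s ^ 2 ≤ 1 := by nlinarith
  have hC8 : 4 * c - s ^ 2 ≤ 8 := by nlinarith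
  have hc1 : 1 ≤ c := by nlinarith
  have hc2 : c ≤ 2 := by omega
  have hcases : c = 2 ∧ t ^ 2 = 1 ∧
      ((s = 0 ∧ r ^ 2 = 1) ∨ (r = 0 ∧ s ^ 2 = 1) ∨ (r = s * t ∧ s ^ 2 = 1)) := by
    have hr1 : -1 ≤ r := by
      have : s * t ≤ 1 := by nlinarith
      nlinarith [sq_nonneg t]
    have hr2 : r ≤ 1 := by
      have : s * t ≤ 1 := by nlinarith
      nlinarith [sq_nonneg t]
    exact eq_of_bounds_of_disc ⟨hc1, hc2⟩ ⟨hr1, hr2⟩ ⟨hs1, hs2⟩ ⟨ht1, ht2⟩ (by linarith)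
  obtain ⟨rfl, ht1, ⟨rfl, hr⟩ | ⟨rfl, hs⟩ | ⟨rfl, hs⟩⟩ := hcases
  · exact ⟨x, t * y, t * r * z, by
      linear_combination h4 + (y ^ 2 + r * y * z + 2 * r ^ 2 * z ^ 2) * ht1 + 2 * z ^ 2 * hr⟩
  · exact ⟨y, t * x, t * s * z, by
      linear_combination h4 + (x ^ 2 + s * x * z + 2 * s ^ 2 * z ^ 2) * ht1 + 2 * z ^ 2 * hs⟩
  · exact ⟨x, -x - t * y, -s * z, by
      linear_combination h4 + y ^ 2 * ht1 + 2 * z ^ 2 * hs⟩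

/-- Every positive ternary form of half-discriminant `5` is equivalent to
`u² + uv + v² + vw + 2w²`. -/
theorem representedByReduced (h : RepresentsDiscFive k a b c r s t) :
    RepresentedByReduced k := by
  obtain ⟨N, hN⟩ : ∃ N : ℕ, a.toNat = N := ⟨_, rfl⟩
  induction N using Nat.strong_induction_on generalizing a b c r s t with
  | _ N ihN =>
  obtain ⟨M, hM⟩ : ∃ M : ℕ, (4 * a * b - t ^ 2).toNat = M := ⟨_, rfl⟩
  induction M using Nat.strong_induction_on generalizing a b c r s t with
  | _ M ihM =>
  obtain ⟨m₁, hm₁⟩ := exists_shift_mem_Icc t a h.pos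
  have h₁ := h.shift_x_y m₁
  have hM₁ : (4 * a * (b + t * m₁ + a * m₁ ^ 2) - (t + 2 * a * m₁) ^ 2).toNat = M := by
    rw [← hM]; congr 1; ring
  generalize b + t * m₁ + a * m₁ ^ 2 = b₁, r + s * m₁ = r₁, t + 2 * a * m₁ = t₁ at *
  obtain ⟨m₂, hm₂⟩ := exists_shift_mem_Icc (2 * (2 * a * r₁ - s * t₁)) _ h₁.minor_pos
  have h₂ := h₁.shift_y_z m₂
  have hB₂ : 2 * (2 * a * r₁ - s * t₁) + 2 * (4 * a * b₁ - t₁ ^ 2) * m₂ =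
      2 * (2 * a * (r₁ + 2 * b₁ * m₂) - (s + t₁ * m₂) * t₁) := by ring
  rw [hB₂] at hm₂
  generalize c + r₁ * m₂ + b₁ * m₂ ^ 2 = c₂, r₁ + 2 * b₁ * m₂ = r₂, s + t₁ * m₂ = s₂ at *
  obtain ⟨m₃, hm₃⟩ := exists_shift_mem_Icc s₂ a h.pos
  have h₃ := h₂.shift_x_z m₃
  have hB₃ : 2 * (2 * a * r₂ - s₂ * t₁) =
      2 * (2 * a * (r₂ + t₁ * m₃) - (s₂ + 2 * a * m₃) * t₁) := by ring
  rw [hB₃] at hm₂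
  generalize c₂ + s₂ * m₃ + a * m₃ ^ 2 = c₃, r₂ + t₁ * m₃ = r₃, s₂ + 2 * a * m₃ = s₃ at *
  rcases lt_or_ge b₁ a with hba | hab
  · have := h₃.pos_b
    exact ihN b₁.toNat (by omega) h₃.swap_x_y rfl
  rcases lt_or_ge (4 * a * c₃ - s₃ ^ 2) (4 * a * b₁ - t₁ ^ 2) with hCA | hAC
  · have := h₃.minor_pos
    exact ihM _ (by omega) h₃.swap_y_z hN rfl
  exact h₃.representedByReduced_of_bounds hm₁ hm₃ hab hm₂ hAC

end RepresentsDiscFive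

theorem exists_sq_add_eq_mul_of_jacobiSym_eq_one {p : ℕ} (hp : p.Prime) {d : ℤ}
    (h : jacobiSym (-d) p = 1) : ∃ τ a : ℤ, τ ^ 2 + d = a * p := by
  have := Fact.mk hp
  obtain ⟨y, hy⟩ := ZMod.isSquare_of_jacobiSym_eq_one h
  obtain ⟨τ, rfl⟩ := ZMod.intCast_surjective y
  have : ((τ ^ 2 + d : ℤ) : ZMod p) = 0 := by
    push_cast at hy ⊢
    linear_combination -hy
  obtain ⟨a, ha⟩ := (ZMod.intCast_zmod_eq_zero_iff_dvd _ _).mp this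
  exact ⟨τ, a, by rw [ha, mul_comm]⟩

/-- If `4kδ = 5 + ps²` and `-δ` is a square modulo the prime `p`, then `k` is the last coefficient
of a positive ternary form of half-discriminant `5`. -/
theorem representedByReduced_of_jacobiSym {p : ℕ} (hp : p.Prime) {k d s : ℤ} (hk : 0 < k)
    (hd : 4 * k * d = 5 + p * s ^ 2) (h : jacobiSym (-d) p = 1) : RepresentedByReduced k := by
  obtain ⟨τ, a, ha⟩ := exists_sq_add_eq_mul_of_jacobiSym_eq_one hp h
  have hp0 : (0 : ℤ) < p := by exact_mod_cast hp.pos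
  have hd0 : 0 < d := by
    have : 0 < 4 * k * d := by rw [hd]; positivity
    exact pos_of_mul_pos_right this (by positivity)
  exact RepresentsDiscFive.representedByReduced (a := p) (b := a) (c := k) (r := s) (s := 0)
    (t := 2 * τ)
    ⟨hp0, by nlinarith, by linear_combination hd - 4 * k * ha, 0, 0, 1, by ring⟩

theorem representedByReduced_of_not_dvd {k : ℕ} (hk : 0 < k) (h5 : ¬ 5 ∣ k) :
    RepresentedByReduced k := by
  have hcop : IsCoprime (5 : ℤ) ((4 * k : ℕ) : ℤ) := by
    rw [show (5 : ℤ) = ((5 : ℕ) : ℤ) from rfl, Nat.isCoprime_iff_coprime,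
      Nat.Prime.coprime_iff_not_dvd (by norm_num)]
    omega
  have hε : jacobiSym (-k) (20 * k - 5) = 1 ∨ jacobiSym (-k) (20 * k - 5) = -1 := by
    apply jacobiSym.eq_one_or_neg_one
    rw [← Int.isCoprime_iff_gcd_eq_one]
    push_cast [show 5 ≤ 20 * k by omega]
    have h1 : IsCoprime (k : ℤ) 5 := (hcop.of_isCoprime_of_dvd_right ⟨4, by push_cast; ring⟩).symm
    have h2 : IsCoprime (k : ℤ) (20 * k - 5) := by
      rw [show (20 * k - 5 : ℤ) = -5 + k * 20 by ring]
      exact h1.neg_right.add_mul_left_right 20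
    exact h2.neg_left
  obtain ⟨ρ, hρ5, hρ⟩ : ∃ ρ : ℤ, IsCoprime ρ 5 ∧
      jacobiSym ρ 5 * jacobiSym (-k) (20 * k - 5) = 1 := by
    rcases hε with hε | hε
    · exact ⟨1, isCoprime_one_left, by rw [hε]; norm_num⟩
    · exact ⟨2, ⟨-2, 1, by norm_num⟩, by rw [hε]; norm_num⟩
  obtain ⟨u, v, huv⟩ := hcop
  have hcopA : IsCoprime (-25 * u + 4 * k * v * ρ) ((20 * k : ℕ) : ℤ) := by
    rw [show ((20 * k : ℕ) : ℤ) = 5 * ((4 * k : ℕ) : ℤ) by push_cast; ring]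
    push_cast at huv ⊢
    refine IsCoprime.mul_right ?_ ?_
    · rw [show -25 * u + 4 * k * v * ρ = ρ + 5 * (-5 * u - u * ρ) by linear_combination ρ * huv]
      exact hρ5.add_mul_left_left _
    · have : IsCoprime (-5 : ℤ) (4 * k) := ⟨-u, v, by linear_combination huv⟩
      rw [show -25 * u + 4 * k * v * ρ = -5 + 4 * k * (5 * v + v * ρ) by
        linear_combination -5 * huv]
      exact this.add_mul_left_left _
  obtain ⟨p, hp5, hp, hpmod⟩ :=
    Nat.forall_exists_prime_gt_and_zmodEq 5 (by omega : 20 * k ≠ 0) hcopA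
  obtain ⟨e, he⟩ := hpmod.symm.dvd
  push_cast at he huv
  have hpodd : Odd p := hp.odd_of_ne_two (by omega)
  have hp4k : 4 * k * (5 * e + 5 * v + v * ρ) = (p : ℤ) + 5 := by
    linear_combination -he + 5 * huv
  have hpρ : jacobiSym p 5 = jacobiSym ρ 5 := by
    apply jacobiSym.mod_left'
    push_cast
    apply Int.ModEq.symm
    apply (Int.modEq_iff_dvd).mpr
    exact ⟨4 * k * e - 5 * u - u * ρ, by linear_combination he + ρ * huv⟩
  have hJ5 : jacobiSym 5 p = jacobiSym p 5 := by
    exact_mod_cast jacobiSym.quadratic_reciprocity_one_mod_four (a := 5) (by norm_num) hpodd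
  have hJk : jacobiSym (-k) p = jacobiSym (-k) (20 * k - 5) := by
    rw [jacobiSym.mod_right _ hpodd,
      jacobiSym.mod_right _ (b := 20 * k - 5) (by rw [Nat.odd_iff]; omega)]
    congr 1
    simp only [Int.natAbs_neg, Int.natAbs_natCast]
    apply (Int.natCast_modEq_iff).mp
    apply (Int.modEq_iff_dvd).mpr
    refine ⟨5 - (5 * e + 5 * v + v * ρ), ?_⟩
    push_cast [show 5 ≤ 20 * k by omega]
    linear_combination hp4k
  refine representedByReduced_of_jacobiSym hp (s := 1) (d := 5 * e + 5 * v + v * ρ) (by exact_mod_cast hk)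
    (by linear_combination hp4k) ?_
  generalize 5 * e + 5 * v + v * ρ = d at *
  have hp5' : Int.gcd 5 p = 1 := by
    have : Nat.Coprime 5 p := (Nat.coprime_primes (by norm_num) hp).mpr (by omega)
    exact_mod_cast this
  have hprod : jacobiSym (-d * 4 * (5 * (-k))) p = 1 := by
    rw [← jacobiSym.sq_one' hp5']
    apply jacobiSym.mod_left'
    apply Int.ModEq.symm
    apply (Int.modEq_iff_dvd).mpr
    exact ⟨5, by linear_combination 5 * hp4k⟩
  rw [jacobiSym.mul_left, jacobiSym.mul_left, jacobiSym.mul_left, jacobiSym.at_four hpodd, hJ5,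
    hpρ, hJk, hρ] at hprod
  simpa using hprod

theorem representedByReduced_five_mul {w : ℕ} (hw : w % 5 = 2 ∨ w % 5 = 3) :
    RepresentedByReduced (5 * w) := by
  have hw0 : 0 < w := by omega
  have hcop : IsCoprime (5 : ℤ) ((4 * w : ℕ) : ℤ) := by
    rw [show (5 : ℤ) = ((5 : ℕ) : ℤ) from rfl, Nat.isCoprime_iff_coprime,
      Nat.Prime.coprime_iff_not_dvd (by norm_num)]
    omega
  obtain ⟨u, v, huv⟩ := hcop
  obtain ⟨p, hp5, hp, hpmod⟩ := Nat.forall_exists_prime_gt_and_zmodEq 5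
    (by omega : 4 * w ≠ 0) (a := -u) ⟨-5, v, by linear_combination huv⟩
  obtain ⟨e, he⟩ := hpmod.symm.dvd
  push_cast at he huv
  have hpodd : Odd p := hp.odd_of_ne_two (by omega)
  have hpw : 4 * w * (5 * e + v) = 5 * (p : ℤ) + 1 := by
    linear_combination -5 * he + huv
  generalize 5 * e + v = d at *
  have hJ : jacobiSym (-w) 5 * jacobiSym (-w) p = -1 := by
    have hodd : Odd (4 * w - 1) := by rw [Nat.odd_iff]; omega
    have hbase : jacobiSym (-w) (4 * w - 1) = -1 := by
      have h1 : jacobiSym (4 * (-w)) (4 * w - 1) = jacobiSym (-1) (4 * w - 1) := by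
        apply jacobiSym.mod_left'
        apply (Int.modEq_iff_dvd).mpr
        push_cast [show 1 ≤ 4 * w by omega]
        exact ⟨1, by ring⟩
      rw [jacobiSym.mul_left, jacobiSym.at_four hodd, jacobiSym.at_neg_one hodd,
        ZMod.χ₄_nat_three_mod_four (by omega)] at h1
      simpa using h1
    rw [← jacobiSym.mul_right' _ (by norm_num) hp.ne_zero, ← hbase,
      jacobiSym.mod_right _ (Odd.mul (by decide) hpodd), jacobiSym.mod_right _ hodd]
    congr 1
    simp only [Int.natAbs_neg, Int.natAbs_natCast]
    apply (Int.natCast_modEq_iff).mp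
    apply (Int.modEq_iff_dvd).mpr
    refine ⟨1 - d, ?_⟩
    push_cast [show 1 ≤ 4 * w by omega]
    linear_combination hpw
  have hJw5 : jacobiSym (-w) 5 = -1 := by
    rw [jacobiSym.mod_left]
    rcases hw with hw | hw
    · rw [show (-(w : ℤ)) % (5 : ℕ) = 3 by push_cast; omega]; norm_num
    · rw [show (-(w : ℤ)) % (5 : ℕ) = 2 by push_cast; omega]; norm_num
  have hJw : jacobiSym (-w) p = 1 := by
    rw [hJw5] at hJ; linarith
  refine representedByReduced_of_jacobiSym hp (s := 5) (d := d) (by positivity)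
    (by linear_combination 5 * hpw) ?_
  have hprod : jacobiSym (-d * 4 * (-w)) p = 1 := by
    rw [← jacobiSym.one_left p]
    apply jacobiSym.mod_left'
    apply Int.ModEq.symm
    apply (Int.modEq_iff_dvd).mpr
    exact ⟨5, by linear_combination hpw⟩
  rw [jacobiSym.mul_left, jacobiSym.mul_left, jacobiSym.at_four hpodd, hJw] at hprod
  simpa using hprod

theorem representedByReduced_of_emod {k : ℤ} (hk : 0 < k)
    (h : k % 5 ≠ 0 ∨ k % 25 = 10 ∨ k % 25 = 15) : RepresentedByReduced k := by
  lift k to ℕ using hk.le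
  by_cases h5 : 5 ∣ k
  · obtain ⟨w, rfl⟩ := h5
    exact_mod_cast representedByReduced_five_mul (w := w) (by omega)
  · exact representedByReduced_of_not_dvd (by omega) h5

/-- Reflecting in roots of the hexagonal sublattice makes the second coordinate even. -/
theorem RepresentedByReduced.exists_even {k : ℤ} (h : RepresentedByReduced k) :
    ∃ u z w : ℤ, u ^ 2 + u * (2 * z) + (2 * z) ^ 2 + 2 * z * w + 2 * w ^ 2 = k := by
  obtain ⟨u, v, w, h⟩ := h
  rcases Int.even_or_odd' v with ⟨z, rfl | rfl⟩
  · exact ⟨u, z, w, h⟩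
  · rcases Int.even_or_odd' (u - w) with ⟨y, hy | hy⟩
    · exact ⟨2 * z + 1 + w, y, w, by rw [← hy]; linear_combination h⟩
    · refine ⟨u, -(z + w + y + 1), w, ?_⟩
      rw [show 2 * -(z + w + y + 1) = -u - (2 * z + 1) - w by linear_combination hy]
      linear_combination h

theorem RepresentedByReduced.two_mul {k : ℤ} (h : RepresentedByReduced k) :
    ∃ x y z : ℤ, x ^ 2 + 5 * y ^ 2 + 2 * z ^ 2 = 2 * k := by
  obtain ⟨u, z, w, h⟩ := h.exists_even
  exact ⟨2 * w + z, z, u + z, by linear_combination 2 * h⟩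

theorem RepresentedByReduced.two_mul_of_emod_four {k : ℤ} (h : RepresentedByReduced k)
    (hk : k % 4 = 3) : ∃ x y z : ℤ, x ^ 2 + 5 * y ^ 2 + 8 * z ^ 2 = 2 * k := by
  suffices hs : ∃ u z w y : ℤ, u + z = 2 * y ∧
      u ^ 2 + u * (2 * z) + (2 * z) ^ 2 + 2 * z * w + 2 * w ^ 2 = k by
    obtain ⟨u, z, w, y, hy, h⟩ := hs
    refine ⟨2 * w + z, z, y, ?_⟩
    linear_combination 2 * h - 2 * (u + z + 2 * y) * hy
  obtain ⟨u, z, w, h⟩ := h.exists_even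
  rcases Int.even_or_odd' (u + z) with ⟨y, hy | hy⟩
  · exact ⟨u, z, w, y, hy, h⟩
  have key : z % 2 = 0 ∧ w % 2 = 1 := by
    obtain rfl : u = 2 * y + 1 - z := by linarith
    rcases Int.even_or_odd' z with ⟨z', rfl | rfl⟩ <;>
      rcases Int.even_or_odd' w with ⟨w', rfl | rfl⟩ <;> ring_nf at h <;> omega
  obtain ⟨z', rfl⟩ : ∃ z', z = 2 * z' := ⟨z / 2, by omega⟩
  obtain ⟨w', rfl⟩ : ∃ w', w = 2 * w' + 1 := ⟨w / 2, by omega⟩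
  obtain ⟨f, rfl⟩ : ∃ f, u = 2 * w' + 1 + 2 * f := ⟨(u - (2 * w' + 1)) / 2, by omega⟩
  rcases Int.even_or_odd' f with ⟨g, rfl | rfl⟩
  · exact ⟨2 * w' + 1 + 2 * (2 * g), -(2 * g + (2 * w' + 1) + 2 * z'), 2 * w' + 1, g - z',
      by ring, by linear_combination h⟩
  · exact ⟨2 * (2 * z') + (2 * w' + 1), 2 * g + 1, 2 * w' + 1, 2 * z' + w' + g + 1,
      by ring, by linear_combination h⟩

theorem RepresentedByReduced.of_two_mul_odd {n : ℤ} (h : RepresentedByReduced (2 * n))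
    (hn : n % 2 = 1) : ∃ x y z : ℤ, x ^ 2 + 5 * y ^ 2 + 2 * z ^ 2 = n := by
  obtain ⟨u, z, w, h⟩ := h.exists_even
  have key : z % 2 = 0 ∧ u % 2 = 0 := by
    rcases Int.even_or_odd' z with ⟨z', rfl | rfl⟩ <;>
      rcases Int.even_or_odd' w with ⟨w', rfl | rfl⟩ <;>
      rcases Int.even_or_odd' u with ⟨u', rfl | rfl⟩ <;>
      rcases Int.even_or_odd' w' with ⟨w'', rfl | rfl⟩ <;> ring_nf at h <;> omega
  obtain ⟨z', rfl⟩ : ∃ z', z = 2 * z' := ⟨z / 2, by omega⟩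
  obtain ⟨u', rfl⟩ : ∃ u', u = 2 * u' := ⟨u / 2, by omega⟩
  refine ⟨w + z', z', u' + z', ?_⟩
  have : 2 * ((w + z') ^ 2 + 5 * z' ^ 2 + 2 * (u' + z') ^ 2) = 2 * n := by
    linear_combination h
  linarith

/-- The integers represented by `x² + 5y² + 8z²` that are not divisible by `25`. -/
theorem exists_sq_add_five_mul_sq_add_eight_mul_sq {n : ℤ} (hn : 0 < n)
    (hmod : n % 4 = 0 ∨ n % 4 = 1 ∨ n % 8 = 6)
    (h5 : n % 5 ≠ 0 ∨ n % 25 = 5 ∨ n % 25 = 20) :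
    ∃ x y z : ℤ, x ^ 2 + 5 * y ^ 2 + 8 * z ^ 2 = n := by
  rcases hmod with h4 | h4 | h4
  · obtain ⟨m, rfl⟩ : ∃ m, n = 4 * m := ⟨n / 4, by omega⟩
    obtain ⟨x, y, z, h⟩ : ∃ x y z : ℤ, x ^ 2 + 5 * y ^ 2 + 2 * z ^ 2 = m := by
      rcases Int.even_or_odd' m with ⟨k, rfl | rfl⟩
      · exact (representedByReduced_of_emod (k := k) (by omega) (by omega)).two_mul
      · exact (representedByReduced_of_emod (k := 2 * (2 * k + 1)) (by omega)
          (by omega)).of_two_mul_odd (by omega)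
    exact ⟨2 * x, 2 * y, z, by linear_combination 4 * h⟩
  · obtain ⟨x, y, z, h⟩ := (representedByReduced_of_emod (k := 2 * n) (by omega)
      (by omega)).of_two_mul_odd (by omega)
    have hz : z % 2 = 0 := by
      rcases Int.even_or_odd' x with ⟨x', rfl | rfl⟩ <;>
        rcases Int.even_or_odd' y with ⟨y', rfl | rfl⟩ <;>
        rcases Int.even_or_odd' z with ⟨z', rfl | rfl⟩ <;> ring_nf at h <;> omega
    obtain ⟨z', rfl⟩ : ∃ z', z = 2 * z' := ⟨z / 2, by omega⟩
    exact ⟨x, y, z', by linear_combination h⟩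
  · obtain ⟨k, rfl⟩ : ∃ k, n = 2 * k := ⟨n / 2, by omega⟩
    exact (representedByReduced_of_emod (k := k) (by omega)
      (by omega)).two_mul_of_emod_four (by omega)

theorem exists_quaternary (n : ℤ) (hn : 0 ≤ n) (hmod : n % 4 = 0 ∨ n % 4 = 1 ∨ n % 8 = 6) :
    ∃ x1 x2 y1 y2 : ℤ, x1^2 + 5*x2^2 + 8*y1^2 + 40*y2^2 = n := by
  obtain ⟨N, hN⟩ : ∃ N : ℕ, n.toNat = N := ⟨_, rfl⟩
  induction N using Nat.strong_induction_on generalizing n with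
  | _ N ih =>
  rcases hn.eq_or_lt with rfl | hpos
  · exact ⟨0, 0, 0, 0, by norm_num⟩
  have sub (w : ℤ) (hw : 0 < n - 40 * w ^ 2)
      (h5 : n % 5 ≠ 0 ∨ (n - 40 * w ^ 2) % 25 = 5 ∨ (n - 40 * w ^ 2) % 25 = 20) :
      ∃ x1 x2 y1 y2 : ℤ, x1^2 + 5*x2^2 + 8*y1^2 + 40*y2^2 = n := by
    obtain ⟨x, y, z, h⟩ :=
      exists_sq_add_five_mul_sq_add_eight_mul_sq hw (by omega) (by omega)
    exact ⟨x, y, z, w, by linear_combination h⟩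
  by_cases h0 : n % 25 = 0
  · obtain ⟨m, rfl⟩ : ∃ m, n = 25 * m := ⟨n / 25, by omega⟩
    obtain ⟨x1, x2, y1, y2, h⟩ := ih m.toNat (by omega) m (by omega) (by omega) rfl
    exact ⟨5 * x1, 5 * x2, 5 * y1, 5 * y2, by linear_combination 25 * h⟩
  by_cases h10 : n % 25 = 10
  · exact sub 1 (by omega) (by omega)
  by_cases h15 : n % 25 = 15
  · rcases lt_or_ge 160 n with h160 | h160
    · exact sub 2 (by omega) (by omega)
    · obtain rfl | rfl | rfl : n = 40 ∨ n = 65 ∨ n = 140 := by omega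
      · exact ⟨0, 0, 0, 1, by norm_num⟩
      · exact ⟨5, 0, 0, 1, by norm_num⟩
      · exact ⟨10, 0, 0, 1, by norm_num⟩
  exact sub 0 (by omega) (by omega)

theorem stmt_9 (n : ℤ) (hn : 0 ≤ n) :
    (∃ x1 x2 y1 y2 : ℤ, x1^2 + 5*x2^2 + 8*y1^2 + 40*y2^2 = n) ↔
    (n % 4 = 0 ∨ n % 4 = 1 ∨ n % 8 = 6) := by
  refine ⟨?_, exists_quaternary n hn⟩
  rintro ⟨x1, x2, y1, y2, h⟩
  have hsq (x : ℤ) : x ^ 2 % 8 = 0 ∨ x ^ 2 % 8 = 1 ∨ x ^ 2 % 8 = 4 := by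
    have : x % 8 = 0 ∨ x % 8 = 1 ∨ x % 8 = 2 ∨ x % 8 = 3 ∨ x % 8 = 4 ∨ x % 8 = 5 ∨
      x % 8 = 6 ∨ x % 8 = 7 := by omega
    rcases this with h | h | h | h | h | h | h | h <;> simp [pow_two, Int.mul_emod, h]
  have h1 := hsq x1
  have h2 := hsq x2
  omega
end

section
/- A nonnegative integer n is represented by the quaternary quadratic form x₁² + 5x₂² + 10y₁² + 50y₂² if and only if n ≡ 0, 1 or 4 (mod 5). (This is the regularity of the binary Hermitian lattice ⟨1,10⟩ over ℚ(√-5), stated for its associated quadratic form.) -/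
/-- The value at `(x, y, z)` of the ternary quadratic form with Gram matrix
`!![a, b, c; b, d, e; c, e, f]`. -/
def ternaryForm (a b c d e f x y z : ℤ) : ℤ :=
  a * x ^ 2 + d * y ^ 2 + f * z ^ 2 + 2 * b * x * y + 2 * c * x * z + 2 * e * y * z

/-- The form with Gram matrix `!![a, b, c; b, d, e; c, e, f]` is positive definite of determinant
`10`, every vector which is isotropic modulo `5` lies in the radical modulo `5`, and the form
represents `N`. -/
structure IsAdmissible (N a b c d e f : ℤ) : Prop where
  pos : 0 < a
  minor_pos : 0 < a * d - b ^ 2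
  det : a * (d * f - e ^ 2) - b * (b * f - c * e) + c * (b * e - c * d) = 10
  aniso : ∀ x y z : ℤ, 5 ∣ ternaryForm a b c d e f x y z →
    5 ∣ a * x + b * y + c * z ∧ 5 ∣ b * x + d * y + e * z ∧ 5 ∣ c * x + e * y + f * z
  rep : ∃ x y z : ℤ, ternaryForm a b c d e f x y z = N

namespace IsAdmissible

variable {N a b c d e f : ℤ}

theorem minor_mul_minor (h : IsAdmissible N a b c d e f) :
    (a * d - b ^ 2) * (a * f - c ^ 2) = (a * e - b * c) ^ 2 + 10 * a := by
  linear_combination a * h.det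

theorem swap_fst_snd (h : IsAdmissible N a b c d e f) : IsAdmissible N d b e a c f where
  pos := by nlinarith [h.pos, h.minor_pos, sq_nonneg b]
  minor_pos := by linarith [h.minor_pos]
  det := by linear_combination h.det
  aniso x y z hxyz := by
    obtain ⟨h₁, h₂, h₃⟩ := h.aniso y x z (by
      convert hxyz using 1
      unfold ternaryForm
      ring)
    refine ⟨?_, ?_, ?_⟩
    · convert h₂ using 1
      ring
    · convert h₁ using 1
      ring
    · convert h₃ using 1
      ring
  rep := by
    obtain ⟨x, y, z, hxyz⟩ := h.rep
    refine ⟨y, x, z, ?_⟩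
    rw [← hxyz]
    unfold ternaryForm
    ring

theorem swap_snd_thd (h : IsAdmissible N a b c d e f) : IsAdmissible N a c b f e d where
  pos := h.pos
  minor_pos := by
    have := h.minor_mul_minor
    have := h.pos
    refine pos_of_mul_pos_right (a := a * d - b ^ 2) ?_ h.minor_pos.le
    nlinarith [sq_nonneg (a * e - b * c)]
  det := by linear_combination h.det
  aniso x y z hxyz := by
    obtain ⟨h₁, h₂, h₃⟩ := h.aniso x z y (by
      convert hxyz using 1
      unfold ternaryForm
      ring)
    refine ⟨?_, ?_, ?_⟩
    · convert h₁ using 1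
      ring
    · convert h₃ using 1
      ring
    · convert h₂ using 1
      ring
  rep := by
    obtain ⟨x, y, z, hxyz⟩ := h.rep
    refine ⟨x, z, y, ?_⟩
    rw [← hxyz]
    unfold ternaryForm
    ring

theorem shear_snd_fst (h : IsAdmissible N a b c d e f) (k : ℤ) :
    IsAdmissible N a (b + k * a) c (d + 2 * k * b + k ^ 2 * a) (e + k * c) f where
  pos := h.pos
  minor_pos := by
    convert h.minor_pos using 1
    ring
  det := by linear_combination h.det
  aniso x y z hxyz := by
    obtain ⟨⟨u, hu⟩, ⟨v, hv⟩, ⟨w, hw⟩⟩ := h.aniso (x + k * y) y z (by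
      convert hxyz using 1
      unfold ternaryForm
      ring)
    exact ⟨⟨u, by linear_combination hu⟩, ⟨v + k * u, by linear_combination hv + k * hu⟩,
      ⟨w, by linear_combination hw⟩⟩
  rep := by
    obtain ⟨x, y, z, hxyz⟩ := h.rep
    refine ⟨x - k * y, y, z, ?_⟩
    rw [← hxyz]
    unfold ternaryForm
    ring

theorem shear_thd_fst (h : IsAdmissible N a b c d e f) (k : ℤ) :
    IsAdmissible N a b (c + k * a) d (e + k * b) (f + 2 * k * c + k ^ 2 * a) :=
  (h.swap_snd_thd.shear_snd_fst k).swap_snd_thd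

theorem shear_thd_snd (h : IsAdmissible N a b c d e f) (k : ℤ) :
    IsAdmissible N a b (c + k * b) d (e + k * d) (f + 2 * k * e + k ^ 2 * d) :=
  (h.swap_fst_snd.shear_thd_fst k).swap_fst_snd

theorem exists_centered_residue {m : ℤ} (hm : 0 < m) (r : ℤ) :
    ∃ k : ℤ, -m ≤ 2 * (r + k * m) ∧ 2 * (r + k * m) ≤ m := by
  refine ⟨-((2 * r + m) / (2 * m)), ?_, ?_⟩
  · nlinarith [Int.mul_ediv_self_le (x := 2 * r + m) (k := 2 * m) (by omega)]
  · nlinarith [Int.lt_mul_ediv_self_add (x := 2 * r + m) (k := 2 * m) (by omega)]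

/-- Every admissible form is equivalent to one reduced in the sense of Hermite. -/
theorem exists_reduced (h : IsAdmissible N a b c d e f) :
    ∃ a b c d e f : ℤ, IsAdmissible N a b c d e f ∧ a ≤ d ∧ -a ≤ 2 * b ∧ 2 * b ≤ a ∧
      -a ≤ 2 * c ∧ 2 * c ≤ a ∧ a * d - b ^ 2 ≤ a * f - c ^ 2 ∧
      -(a * d - b ^ 2) ≤ 2 * (a * e - b * c) ∧ 2 * (a * e - b * c) ≤ a * d - b ^ 2 := by
  classical
  have hP : ∃ m : ℕ, ∃ b c d e f : ℤ, IsAdmissible N m b c d e f :=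
    ⟨a.toNat, b, c, d, e, f, by rwa [Int.toNat_of_nonneg h.pos.le]⟩
  obtain ⟨m, ⟨b₀, c₀, d₀, e₀, f₀, h₀⟩, hm⟩ : ∃ m : ℕ,
      (∃ b c d e f : ℤ, IsAdmissible N m b c d e f) ∧
      ∀ a b c d e f : ℤ, IsAdmissible N a b c d e f → (m : ℤ) ≤ a := by
    refine ⟨Nat.find hP, Nat.find_spec hP, fun a b c d e f h => ?_⟩
    have := Nat.find_min' hP
      ⟨b, c, d, e, f, (by rwa [Int.toNat_of_nonneg h.pos.le] :
        IsAdmissible N (a.toNat : ℤ) b c d e f)⟩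
    have := h.pos
    omega
  have hQ : ∃ k : ℕ, ∃ b c d e f : ℤ, IsAdmissible N m b c d e f ∧ m * d - b ^ 2 = k :=
    ⟨(m * d₀ - b₀ ^ 2).toNat, b₀, c₀, d₀, e₀, f₀, h₀, (Int.toNat_of_nonneg h₀.minor_pos.le).symm⟩
  obtain ⟨k, ⟨b₁, c₁, d₁, e₁, f₁, h₁, hk₁⟩, hk⟩ : ∃ k : ℕ,
      (∃ b c d e f : ℤ, IsAdmissible N m b c d e f ∧ m * d - b ^ 2 = k) ∧
      ∀ b c d e f : ℤ, IsAdmissible N m b c d e f → (k : ℤ) ≤ m * d - b ^ 2 := by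
    refine ⟨Nat.find hQ, Nat.find_spec hQ, fun b c d e f h => ?_⟩
    have := Nat.find_min' hQ
      ⟨b, c, d, e, f, h, (Int.toNat_of_nonneg h.minor_pos.le).symm⟩
    have := h.minor_pos
    omega
  obtain ⟨r, hr₁, hr₂⟩ := exists_centered_residue h₁.pos b₁
  have h₂ := h₁.shear_snd_fst r
  set b₂ := b₁ + r * m with hb₂
  set d₂ := d₁ + 2 * r * b₁ + r ^ 2 * m with hd₂
  set e₂ := e₁ + r * c₁
  have hk₂ : m * d₂ - b₂ ^ 2 = k := by
    rw [← hk₁, hb₂, hd₂]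
    ring
  obtain ⟨s, hs₁, hs₂⟩ := exists_centered_residue h₂.minor_pos (m * e₂ - b₂ * c₁)
  have h₃ := h₂.shear_thd_snd s
  obtain ⟨t, ht₁, ht₂⟩ := exists_centered_residue h₁.pos (c₁ + s * b₂)
  have h₄ := h₃.shear_thd_fst t
  refine ⟨_, _, _, _, _, _, h₄, hm _ _ _ _ _ _ h₄.swap_fst_snd, hr₁, hr₂, ht₁, ht₂, ?_, ?_, ?_⟩
  · rw [hk₂]
    exact hk _ _ _ _ _ h₄.swap_snd_thd
  · linarith
  · linarith

end IsAdmissible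

/-- The even form with Gram matrix `!![2, 1, 1; 1, 2, 1; 1, 1, 4]` represents only numbers
represented by `⟨1, 2, 5⟩`. -/
theorem exists_rep_of_even_form (x y z : ℤ) : ∃ u v w : ℤ,
    2 * x ^ 2 + 2 * y ^ 2 + 4 * z ^ 2 + 2 * x * y + 2 * x * z + 2 * y * z =
      u ^ 2 + 2 * v ^ 2 + 5 * w ^ 2 := by
  have key : 2 ∣ y + z ∨ 2 ∣ x + z ∨ 2 ∣ x + y := by omega
  rcases key with ⟨s, hs⟩ | ⟨s, hs⟩ | ⟨s, hs⟩
  · obtain rfl : y = 2 * s - z := by linarith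
    exact ⟨s - 2 * z, x + s, s, by ring⟩
  · obtain rfl : x = 2 * s - z := by linarith
    exact ⟨s - 2 * z, y + s, s, by ring⟩
  · obtain rfl : y = 2 * s - x := by linarith
    exact ⟨s + 2 * z, x - s, s, by ring⟩

theorem IsAdmissible.exists_rep {N a b c d e f : ℤ} (h : IsAdmissible N a b c d e f) :
    ∃ x y z : ℤ, N = x ^ 2 + 2 * y ^ 2 + 5 * z ^ 2 := by
  obtain ⟨a, b, c, d, e, f, h, had, hb₁, hb₂, hc₁, hc₂, hG, hg₁, hg₂⟩ := h.exists_reduced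
  have hmin := h.minor_mul_minor
  have ha := h.pos
  have hdet := h.det
  have hiso : ¬ ((5 : ℤ) ∣ ternaryForm a b c d e f 1 2 0 ∧ ¬ (5 : ℤ) ∣ a + 2 * b) := by
    rintro ⟨h₁, h₂⟩
    have := (h.aniso 1 2 0 h₁).1
    apply h₂
    convert this using 1
    ring
  obtain ⟨x, y, z, rfl⟩ := h.rep
  have hpos := h.minor_pos
  clear h
  have hG_sq : 3 * (a * d - b ^ 2) ^ 2 ≤ 40 * a := by
    nlinarith [mul_nonneg (sub_nonneg.2 hg₁) (sub_nonneg.2 hg₂),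
      mul_le_mul_of_nonneg_left hG hpos.le]
  have hGa : 3 * a ^ 2 ≤ 4 * (a * d - b ^ 2) := by nlinarith
  have ha₂ : a ≤ 2 := by
    by_contra! hlt
    have h₁ : (3 * a ^ 2) ^ 2 ≤ (4 * (a * d - b ^ 2)) ^ 2 := pow_le_pow_left₀ (by positivity) hGa 2
    have h₂ : 27 * a ^ 3 ≤ 640 := by
      have : a * (27 * a ^ 3) ≤ a * 640 := by nlinarith
      exact le_of_mul_le_mul_left this ha
    nlinarith [pow_le_pow_left₀ (by norm_num) (show (3 : ℤ) ≤ a by omega) 3]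
  have hG₅ : a * d - b ^ 2 ≤ 5 := by nlinarith
  obtain rfl | rfl : a = 1 ∨ a = 2 := by omega
  · obtain rfl : b = 0 := by omega
    obtain rfl : c = 0 := by omega
    have hd : d ≤ 3 := by nlinarith
    have he₁ : -1 ≤ e := by omega
    have he₂ : e ≤ 1 := by omega
    interval_cases d <;> interval_cases e <;> try omega
    · obtain rfl : f = 10 := by omega
      exact absurd (by unfold ternaryForm; norm_num) hiso
    · obtain rfl : f = 5 := by omega
      exact ⟨x, y, z, by unfold ternaryForm; ring⟩
  · have hb : b = -1 ∨ b = 0 ∨ b = 1 := by omega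
    have hc : c = -1 ∨ c = 0 ∨ c = 1 := by omega
    have hd : d ≤ 3 := by rcases hb with rfl | rfl | rfl <;> omega
    have he₁ : -2 ≤ e := by
      rcases hb with rfl | rfl | rfl <;> rcases hc with rfl | rfl | rfl <;> omega
    have he₂ : e ≤ 2 := by
      rcases hb with rfl | rfl | rfl <;> rcases hc with rfl | rfl | rfl <;> omega
    have hE := exists_rep_of_even_form
    rcases hb with rfl | rfl | rfl <;> rcases hc with rfl | rfl | rfl <;>
      interval_cases d <;> interval_cases e <;> try omega
    all_goals first
      | exfalso
        apply hiso
        unfold ternaryForm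
        norm_num
        done
      | obtain rfl : f = 4 := by omega
        first
          | obtain ⟨u, v, w, huvw⟩ := hE x y z
            refine ⟨u, v, w, ?_⟩
            rw [← huvw]
            unfold ternaryForm
            ring1
          | obtain ⟨u, v, w, huvw⟩ := hE (-x) y z
            refine ⟨u, v, w, ?_⟩
            rw [← huvw]
            unfold ternaryForm
            ring1
          | obtain ⟨u, v, w, huvw⟩ := hE x (-y) z
            refine ⟨u, v, w, ?_⟩
            rw [← huvw]
            unfold ternaryForm
            ring1
          | obtain ⟨u, v, w, huvw⟩ := hE x y (-z)
            refine ⟨u, v, w, ?_⟩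
            rw [← huvw]
            unfold ternaryForm
            ring1
          | obtain ⟨u, v, w, huvw⟩ := hE (x + y) (-y) z
            refine ⟨u, v, w, ?_⟩
            rw [← huvw]
            unfold ternaryForm
            ring1
          | obtain ⟨u, v, w, huvw⟩ := hE (x + y) (-y) (-z)
            refine ⟨u, v, w, ?_⟩
            rw [← huvw]
            unfold ternaryForm
            ring1
          | obtain ⟨u, v, w, huvw⟩ := hE (x - y) y z
            refine ⟨u, v, w, ?_⟩
            rw [← huvw]
            unfold ternaryForm
            ring1
          | obtain ⟨u, v, w, huvw⟩ := hE (y - x) (-y) z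
            refine ⟨u, v, w, ?_⟩
            rw [← huvw]
            unfold ternaryForm
            ring1

theorem exists_dvd_sq_sub_of_jacobiSym_eq_one {p : ℕ} (hp : p.Prime) {a : ℤ}
    (h : jacobiSym a p = 1) : ∃ b : ℤ, (p : ℤ) ∣ b ^ 2 - a := by
  have := Fact.mk hp
  obtain ⟨r, hr⟩ := ZMod.isSquare_of_jacobiSym_eq_one h
  obtain ⟨b, rfl⟩ := ZMod.intCast_surjective r
  refine ⟨b, (ZMod.intCast_zmod_eq_zero_iff_dvd _ _).1 ?_⟩
  push_cast
  rw [hr]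
  ring

theorem jacobiSym_five {n : ℕ} (hn : Odd n) : jacobiSym 5 n = jacobiSym (n % 5 : ℕ) 5 := by
  have := jacobiSym.quadratic_reciprocity_one_mod_four (a := 5) (b := n) (by norm_num) hn
  rw [Nat.cast_ofNat] at this
  rw [this]
  apply jacobiSym.mod_left'
  push_cast
  simp

theorem five_dvd_of_dvd_sq_add {D s t : ℤ} (hD : D % 5 = 2 ∨ D % 5 = 3)
    (h : 5 ∣ s ^ 2 + D * t ^ 2) : 5 ∣ s ∧ 5 ∣ t := by
  have key : (s % 5) = 0 ∧ t % 5 = 0 := by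
    have hmod : (s ^ 2 + D * t ^ 2) % 5 = 0 := by omega
    have hs : s % 5 = 0 ∨ s % 5 = 1 ∨ s % 5 = 2 ∨ s % 5 = 3 ∨ s % 5 = 4 := by omega
    have ht : t % 5 = 0 ∨ t % 5 = 1 ∨ t % 5 = 2 ∨ t % 5 = 3 ∨ t % 5 = 4 := by omega
    rcases hD with hD | hD <;> rcases hs with hs | hs | hs | hs | hs <;>
      rcases ht with ht | ht | ht | ht | ht <;>
      simp [pow_two, Int.add_emod, Int.mul_emod, hD, hs, ht] at hmod ⊢
  omega

theorem exists_dvd_sq_add_of_odd {n : ℕ} (hn : Odd n) (hn₅ : n % 5 = 1 ∨ n % 5 = 4) :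
    ∃ d D : ℕ, 0 < d ∧ n * D = 5 * d + 2 ∧ ∃ b : ℤ, (d : ℤ) ∣ b ^ 2 + D := by
  have hn_pos : 0 < n := hn.pos
  obtain ⟨k, hk₅, hk₈⟩ : ∃ k : ℕ, k % 5 = 2 ∧
      (k % 8 = 7 ∧ (n % 8 = 1 ∨ n % 8 = 3) ∨ k % 8 = 3 ∧ (n % 8 = 5 ∨ n % 8 = 7)) := by
    obtain ⟨m, rfl⟩ := hn
    by_cases h : (2 * m + 1) % 8 = 1 ∨ (2 * m + 1) % 8 = 3
    · exact ⟨7, rfl, Or.inl ⟨rfl, h⟩⟩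
    · exact ⟨27, rfl, Or.inr ⟨rfl, by omega⟩⟩
  have hsq₅ : n ^ 2 % 5 = 1 := by
    rcases hn₅ with h | h <;> simp [Nat.pow_mod, h]
  have hsq₈ : n ^ 2 % 8 = 1 := by
    rcases hk₈ with ⟨-, h | h⟩ | ⟨-, h | h⟩ <;> simp [Nat.pow_mod, h]
  obtain ⟨c, hc⟩ : ∃ c, k * n ^ 2 = 5 * c + 2 := by
    have : k * n ^ 2 % 5 = 2 := by simp [Nat.mul_mod, hsq₅, hk₅]
    exact ⟨k * n ^ 2 / 5, by omega⟩
  have hc₈ : k * n ^ 2 % 8 = k % 8 := by simp [Nat.mul_mod, hsq₈]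
  have hcop : c.Coprime (8 * n) := by
    refine Nat.Coprime.mul_right ?_ ?_
    · rw [show 8 = 2 ^ 3 by rfl]
      exact Nat.Coprime.pow_right 3 (Nat.coprime_two_right.2 (Nat.odd_iff.2 (by omega)))
    · refine Nat.coprime_of_dvd fun q hq hqc hqn => ?_
      have h₁ : q ∣ 5 * c + 2 := hc ▸ (dvd_pow hqn two_ne_zero).mul_left k
      have h₂ : q ∣ 2 := (Nat.dvd_add_right (hqc.mul_left 5)).1 h₁
      obtain rfl := (Nat.prime_dvd_prime_iff_eq hq Nat.prime_two).1 h₂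
      exact absurd (even_iff_two_dvd.2 hqn) (Nat.not_even_iff_odd.2 hn)
  obtain ⟨p, -, hp, hpc⟩ := Nat.forall_exists_prime_gt_and_modEq 0 (by omega) hcop
  have hp₈ : p % 8 = c % 8 := hpc.of_mul_right n
  obtain ⟨D, hD⟩ : n ∣ 5 * p + 2 := by
    have : 5 * p + 2 ≡ 5 * c + 2 [MOD n] := ((hpc.of_mul_left 8).mul_left 5).add_right 2
    refine (this.dvd_iff dvd_rfl).2 (hc ▸ ?_)
    exact (dvd_pow_self n two_ne_zero).mul_left k
  refine ⟨p, D, hp.pos, hD.symm, ?_⟩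
  have hp_odd : Odd p := Nat.odd_iff.2 (by omega)
  have hD' : (n : ℤ) * D = 5 * p + 2 := by exact_mod_cast hD.symm
  have h_mul : jacobiSym n p * jacobiSym (-D) p = jacobiSym (-2) p := by
    rw [← jacobiSym.mul_left]
    apply jacobiSym.mod_left'
    exact Int.ModEq.symm (Int.modEq_iff_dvd.2 ⟨-5, by linear_combination -hD'⟩)
  have h_recip : jacobiSym p n = jacobiSym (-2) n := by
    have h₅ : jacobiSym 5 n = 1 := by
      rw [jacobiSym_five hn]
      rcases hn₅ with h | h <;> rw [h] <;> norm_num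
    rw [← one_mul (jacobiSym p n), ← h₅, ← jacobiSym.mul_left]
    apply jacobiSym.mod_left'
    exact Int.ModEq.symm (Int.modEq_iff_dvd.2 ⟨D, by linear_combination -hD'⟩)
  rw [jacobiSym.quadratic_reciprocity_one_mod_four' hn (by omega), h_recip,
    jacobiSym.at_neg_two hn, jacobiSym.at_neg_two hp_odd, ZMod.χ₈'_nat_eq_if_mod_eight,
    ZMod.χ₈'_nat_eq_if_mod_eight] at h_mul
  have h_one : jacobiSym (-D) p = 1 := by
    split_ifs at h_mul <;> omega
  simpa using exists_dvd_sq_sub_of_jacobiSym_eq_one hp h_one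

theorem exists_dvd_sq_add_of_two_mul_odd {m : ℕ} (hm : Odd m) (hm₅ : m % 5 = 2 ∨ m % 5 = 3) :
    ∃ d D : ℕ, 0 < d ∧ 2 * m * D = 5 * d + 2 ∧ ∃ b : ℤ, (d : ℤ) ∣ b ^ 2 + D := by
  have hm_pos : 0 < m := hm.pos
  obtain ⟨c, hc⟩ : ∃ c, 4 * m ^ 2 = 5 * c + 1 := by
    have : 4 * m ^ 2 % 5 = 1 := by
      rcases hm₅ with h | h <;> simp [Nat.mul_mod, Nat.pow_mod, h]
    exact ⟨4 * m ^ 2 / 5, by omega⟩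
  have hcop : c.Coprime (4 * m) := by
    refine Nat.coprime_of_dvd fun q hq hqc hqm => hq.one_lt.ne' ?_
    have h₁ : q ∣ 5 * c + 1 := hc ▸ (hqm.mul_right m).trans (dvd_of_eq (by ring))
    exact Nat.dvd_one.1 ((Nat.dvd_add_right (hqc.mul_left 5)).1 h₁)
  obtain ⟨p, -, hp, hpc⟩ := Nat.forall_exists_prime_gt_and_modEq 0 (by omega) hcop
  have hp₄ : p % 4 = 3 := by
    have : p % 4 = c % 4 := hpc.of_mul_right m
    omega
  obtain ⟨D, hD⟩ : m ∣ 5 * p + 1 := by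
    have : 5 * p + 1 ≡ 5 * c + 1 [MOD m] := ((hpc.of_mul_left 4).mul_left 5).add_right 1
    refine (this.dvd_iff dvd_rfl).2 (hc ▸ ?_)
    exact (dvd_pow_self m two_ne_zero).mul_left 4
  have hp_odd : Odd p := Nat.odd_iff.2 (by omega)
  have hD' : (m : ℤ) * D = 5 * p + 1 := by exact_mod_cast hD.symm
  have h_mul : jacobiSym m p * jacobiSym (-D) p = -1 := by
    rw [← ZMod.χ₄_nat_three_mod_four hp₄, ← jacobiSym.at_neg_one hp_odd, ← jacobiSym.mul_left]
    apply jacobiSym.mod_left'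
    exact Int.ModEq.symm (Int.modEq_iff_dvd.2 ⟨-5, by linear_combination -hD'⟩)
  have h_neg : jacobiSym (-p) m = -1 := by
    have h₅ : jacobiSym 5 m = -1 := by
      rw [jacobiSym_five hm]
      rcases hm₅ with h | h <;> rw [h] <;> norm_num
    have : jacobiSym 5 m * jacobiSym (-p) m = 1 := by
      rw [← jacobiSym.mul_left, ← jacobiSym.one_left m]
      apply jacobiSym.mod_left'
      exact Int.ModEq.symm (Int.modEq_iff_dvd.2 ⟨-D, by linear_combination hD'⟩)
    rw [h₅] at this
    omega
  have h_recip : jacobiSym m p = -1 := by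
    rw [← h_neg, jacobiSym.neg _ hm]
    rcases Nat.odd_mod_four_iff.1 (Nat.odd_iff.1 hm) with h | h
    · rw [ZMod.χ₄_nat_one_mod_four h, one_mul,
        jacobiSym.quadratic_reciprocity_one_mod_four h hp_odd]
    · rw [ZMod.χ₄_nat_three_mod_four h, neg_one_mul,
        jacobiSym.quadratic_reciprocity_three_mod_four h hp₄]
  have h_one : jacobiSym (-D) p = 1 := by
    rw [h_recip] at h_mul
    omega
  obtain ⟨b, hb⟩ := exists_dvd_sq_sub_of_jacobiSym_eq_one hp h_one
  rw [sub_neg_eq_add] at hb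
  refine ⟨2 * p, D, by have := hp.pos; omega, by linarith, ?_⟩
  obtain ⟨b', hb', hpar⟩ : ∃ b' : ℤ, (p : ℤ) ∣ b' ^ 2 + D ∧ Even (b' + D) := by
    by_cases h : Even (b + D)
    · exact ⟨b, hb, h⟩
    · refine ⟨b + p, ?_, ?_⟩
      · obtain ⟨q, hq⟩ := hb
        exact ⟨q + 2 * b + p, by linear_combination hq⟩
      · rw [show b + p + (D : ℤ) = b + D + p by ring]
        exact (Int.not_even_iff_odd.1 h).add_odd (by exact_mod_cast hp_odd)
  refine ⟨b', ?_⟩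
  push_cast
  refine IsCoprime.mul_dvd ?_ ?_ hb'
  · exact_mod_cast Nat.isCoprime_iff_coprime.2 (Nat.coprime_two_left.2 hp_odd)
  · rw [← even_iff_two_dvd, Int.even_add, Int.even_pow' two_ne_zero, ← Int.even_add]
    exact hpar

/-- The form `⟨1, 5, 10⟩` represents every positive integer congruent to `±1` modulo `5`. -/
theorem exists_rep_one_five_ten (n : ℕ) (hn : n % 5 = 1 ∨ n % 5 = 4) :
    ∃ x y z : ℤ, (n : ℤ) = x ^ 2 + 5 * y ^ 2 + 10 * z ^ 2 := by
  induction n using Nat.strong_induction_on with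
  | _ n ih =>
    by_cases h4 : n % 4 = 0
    · obtain ⟨m, rfl⟩ := Nat.dvd_of_mod_eq_zero h4
      obtain ⟨x, y, z, h⟩ := ih m (by omega) (by omega)
      refine ⟨2 * x, 2 * y, 2 * z, ?_⟩
      push_cast
      rw [h]
      ring
    · obtain ⟨d, D, hd, hD, b, a, ha⟩ :
          ∃ d D : ℕ, 0 < d ∧ n * D = 5 * d + 2 ∧ ∃ b : ℤ, (d : ℤ) ∣ b ^ 2 + D := by
        rcases Nat.even_or_odd' n with ⟨m, rfl | rfl⟩
        · exact exists_dvd_sq_add_of_two_mul_odd (Nat.odd_iff.2 (by omega)) (by omega)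
        · exact exists_dvd_sq_add_of_odd (odd_two_mul_add_one m) hn
      have hD' : (n : ℤ) * D = 5 * d + 2 := by exact_mod_cast hD
      have hD₀ : 0 < D := Nat.pos_of_ne_zero (by rintro rfl; omega)
      have hD₅ : (D : ℤ) % 5 = 2 ∨ (D : ℤ) % 5 = 3 := by
        have h : n * D % 5 = 2 := by omega
        have : D % 5 < 5 := Nat.mod_lt _ (by norm_num)
        rcases hn with hn | hn <;> rw [Nat.mul_mod, hn] at h <;> omega
      have hd' : (0 : ℤ) < d := by exact_mod_cast hd
      have hD₀' : (0 : ℤ) < D := by exact_mod_cast hD₀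
      have h : IsAdmissible (5 * n) a b 5 d 0 (5 * n) :=
        { pos := by
            refine pos_of_mul_pos_right (a := (d : ℤ)) ?_ hd'.le
            rw [← ha]
            positivity
          minor_pos := by linarith
          det := by linear_combination 5 * hD' - 5 * n * ha
          aniso := fun x y z h => by
            obtain ⟨q, hq⟩ : (5 : ℤ) ∣ a * x ^ 2 + 2 * b * x * y + d * y ^ 2 := by
              obtain ⟨q, hq⟩ := h
              unfold ternaryForm at hq
              exact ⟨q - n * z ^ 2 - 2 * x * z, by linear_combination hq⟩
            have h₁ := (five_dvd_of_dvd_sq_add hD₅ (s := a * x + b * y) (t := y)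
              ⟨a * q, by linear_combination a * hq + y ^ 2 * ha⟩).1
            have h₂ := (five_dvd_of_dvd_sq_add hD₅ (s := b * x + d * y) (t := x)
              ⟨d * q, by linear_combination d * hq + x ^ 2 * ha⟩).1
            exact ⟨by omega, by omega, ⟨x + n * z, by ring⟩⟩
          rep := ⟨0, 0, 1, by unfold ternaryForm; ring⟩ }
      obtain ⟨x, y, z, hxyz⟩ := h.exists_rep
      obtain ⟨⟨u, rfl⟩, ⟨v, rfl⟩⟩ := five_dvd_of_dvd_sq_add (D := 2) (s := x) (t := y) (by norm_num)
        ⟨n - z ^ 2, by linear_combination -hxyz⟩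
      refine ⟨z, u, v, ?_⟩
      linarith

/-- The form `⟨1, 2, 5, 10⟩` is universal. -/
theorem exists_rep_one_two_five_ten (n : ℕ) :
    ∃ x y z w : ℤ, (n : ℤ) = x ^ 2 + 2 * y ^ 2 + 5 * z ^ 2 + 10 * w ^ 2 := by
  induction n using Nat.strong_induction_on with
  | _ n ih =>
    have h_shift : ∀ (k : ℕ) (y : ℤ), (k : ℤ) = 2 * y ^ 2 → k ≤ n →
        ((n - k) % 5 = 1 ∨ (n - k) % 5 = 4) →
        ∃ x y z w : ℤ, (n : ℤ) = x ^ 2 + 2 * y ^ 2 + 5 * z ^ 2 + 10 * w ^ 2 := by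
      intro k y hk hkn hmod
      obtain ⟨x, z, w, h⟩ := exists_rep_one_five_ten (n - k) hmod
      refine ⟨x, y, z, w, ?_⟩
      push_cast [hkn] at h
      linarith
    obtain h | h | h | h : n = 2 ∨ n = 7 ∨ n % 5 = 0 ∨ n % 5 ≠ 0 ∧ n ≠ 2 ∧ n ≠ 7 := by omega
    · exact ⟨0, 1, 0, 0, by simp [h]⟩
    · exact ⟨0, 1, 1, 0, by simp [h]⟩
    · obtain ⟨m, rfl⟩ := Nat.dvd_of_mod_eq_zero h
      rcases Nat.eq_zero_or_pos m with rfl | hm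
      · exact ⟨0, 0, 0, 0, by simp⟩
      obtain ⟨x, y, z, w, h⟩ := ih m (by omega)
      refine ⟨5 * z, 5 * w, x, y, ?_⟩
      push_cast
      rw [h]
      ring
    · obtain h₅ | h₅ | h₅ : (n % 5 = 1 ∨ n % 5 = 4) ∨ n % 5 = 2 ∨ n % 5 = 3 := by omega
      · exact h_shift 0 0 (by norm_num) (by omega) (by omega)
      · exact h_shift 8 2 (by norm_num) (by omega) (by omega)
      · exact h_shift 2 1 (by norm_num) (by omega) (by omega)

theorem stmt_10 (n : ℤ) (hn : 0 ≤ n) :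
    (∃ x1 x2 y1 y2 : ℤ, x1^2 + 5*x2^2 + 10*y1^2 + 50*y2^2 = n) ↔
    (n % 5 = 0 ∨ n % 5 = 1 ∨ n % 5 = 4) := by
  constructor
  · rintro ⟨x, y, z, w, rfl⟩
    have h : x ^ 2 % 5 = 0 ∨ x ^ 2 % 5 = 1 ∨ x ^ 2 % 5 = 4 := by
      have hx : x % 5 = 0 ∨ x % 5 = 1 ∨ x % 5 = 2 ∨ x % 5 = 3 ∨ x % 5 = 4 := by omega
      rcases hx with hx | hx | hx | hx | hx <;> simp [pow_two, Int.mul_emod, hx]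
    omega
  · lift n to ℕ using hn
    intro h
    obtain h | h : n % 5 = 0 ∨ n % 5 = 1 ∨ n % 5 = 4 := by omega
    · obtain ⟨m, rfl⟩ := Nat.dvd_of_mod_eq_zero h
      obtain ⟨x, y, z, w, h⟩ := exists_rep_one_two_five_ten m
      refine ⟨5 * z, x, y, w, ?_⟩
      push_cast
      rw [h]
      ring
    · obtain ⟨x, y, z, h⟩ := exists_rep_one_five_ten n h
      exact ⟨x, y, z, 0, by rw [h]; ring⟩
end
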